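/- arXiv:2103.04840 — 4 statements merged into one kernel-verified Lean document; each statement's English description precedes it below -/
import Mathlib

section
/- Let φ_ℬ : GL_𝒜(V_A^𝒜) → GL_ℬ(V_A^ℬ) be the group homomorphism induced by extension of scalars along φ together with the canonical identification V_A^𝒜 ⊗_𝒜 ℬ ≅ V_A^ℬ (f ⊗ b ↦ b·(φ∘f)). Then the map φ̃_ℬ : (g,M) ↦ (g, φ_ℬ(M)) sends S̃p_A^𝒜(W) into S̃p_A^ℬ(W), is a group homomorphism commuting with the projections to Sp(W), and its kernel is {(id_W, λ·id_{V_A^𝒜}) : λ ∈ 𝒜^×, φ(λ) = 1}, isomorphic to the kernel of the induced map 𝒜^× → ℬ^×. -/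
set_option maxHeartbeats 1000000
set_option synthInstance.maxHeartbeats 1000000

noncomputable section

open scoped TensorProduct

/-! ## The base ring `𝒜`: the integral closure of `ℤ[1/p]` in a cyclotomic field -/

instance cycloAlgebra (p : ℕ) [NeZero p] (m : ℕ+) :
    Algebra (Localization.Away (p : ℤ)) (CyclotomicField m ℚ) :=
  (Localization.awayLift (algebraMap ℤ (CyclotomicField m ℚ)) _
    (by
      rw [map_natCast]
      have h1 : IsUnit ((p : ℕ) : ℚ) :=
        isUnit_iff_ne_zero.mpr (Nat.cast_ne_zero.mpr (NeZero.ne p))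
      have h2 := h1.map (algebraMap ℚ (CyclotomicField m ℚ))
      rwa [map_natCast] at h2)).toAlgebra

/-- The integral closure of `ℤ[1/p]` in the `m`-th cyclotomic field `ℚ(ζ_m)`. -/
def Aint (p : ℕ) [NeZero p] (m : ℕ+) :
    Subalgebra (Localization.Away (p : ℤ)) (CyclotomicField m ℚ) :=
  integralClosure (Localization.Away (p : ℤ)) (CyclotomicField m ℚ)

/-- The ring `𝒜` associated to a finite field of characteristic `p` : the integral
closure of `ℤ[1/p]` in `ℚ(ζ_p)`. -/
def AA (p : ℕ+) : Type := ↥(Aint (p : ℕ) p)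

instance (p : ℕ+) : CommRing (AA p) := inferInstanceAs (CommRing ↥(Aint (p : ℕ) p))

attribute [irreducible] AA

/-! ## The Heisenberg group -/

variable {F : Type*} [Field F] {W : Type*} [AddCommGroup W] [Module F W]

/-- The Heisenberg group attached to the bilinear form `β` : the set `W × F` with
multiplication `(w,t)(w',t') = (w+w', t+t'+½⟨w,w'⟩)`. -/
@[ext]
structure Heis (β : W →ₗ[F] W →ₗ[F] F) : Type _ where
  w : W
  t : F

namespace Heis

variable {β : W →ₗ[F] W →ₗ[F] F}

instance : Mul (Heis β) :=
  ⟨fun a b => ⟨a.w + b.w, a.t + b.t + (2 : F)⁻¹ * β a.w b.w⟩⟩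

instance : One (Heis β) := ⟨⟨0, 0⟩⟩

instance : Inv (Heis β) :=
  ⟨fun a => ⟨-a.w, -a.t + (2 : F)⁻¹ * β a.w a.w⟩⟩

@[simp] lemma mul_w (a b : Heis β) : (a * b).w = a.w + b.w := rfl
@[simp] lemma mul_t (a b : Heis β) :
    (a * b).t = a.t + b.t + (2 : F)⁻¹ * β a.w b.w := rfl
@[simp] lemma one_w : (1 : Heis β).w = 0 := rfl
@[simp] lemma one_t : (1 : Heis β).t = 0 := rfl
@[simp] lemma inv_w (a : Heis β) : a⁻¹.w = -a.w := rfl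
@[simp] lemma inv_t (a : Heis β) :
    a⁻¹.t = -a.t + (2 : F)⁻¹ * β a.w a.w := rfl

instance : Group (Heis β) where
  mul_assoc a b c := by
    ext
    · simp [add_assoc]
    · simp [map_add, LinearMap.add_apply]
      ring
  one_mul a := by ext <;> simp
  mul_one a := by ext <;> simp
  inv_mul_cancel a := by
    ext
    · simp
    · simp [map_neg, LinearMap.neg_apply]

end Heis

/-! ## The induced representation `V_A^ℬ = ind_{A_H}^H(ψ_A^ℬ)` -/

/-- The compactly induced representation `ind_{A_H}^H ψ_A^ℬ`, realised as the
`ℬ`-submodule of functions `f : H → ℬ` with `f(ah) = ψ_A^ℬ(a) f(h)` for `a ∈ A_H`. -/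
def IndV (β : W →ₗ[F] W →ₗ[F] F) (ℬ : Type*) [CommRing ℬ] (A : AddSubgroup W)
    (χ : Heis β → ℬˣ) : Submodule ℬ (Heis β → ℬ) where
  carrier := {f | ∀ a : Heis β, a.w ∈ A → ∀ h : Heis β, f (a * h) = (χ a : ℬ) * f h}
  add_mem' := by
    intro f g hf hg a ha h
    simp only [Pi.add_apply, hf a ha h, hg a ha h, mul_add]
  zero_mem' := by intro a ha h; simp
  smul_mem' := by
    intro c f hf a ha h
    simp only [Pi.smul_apply, smul_eq_mul, hf a ha h]
    ring

/-- Right translation action of `h₀ ∈ H` on functions `H → ℬ`. -/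
def hAct (β : W →ₗ[F] W →ₗ[F] F) (ℬ : Type*) [CommRing ℬ] (h₀ : Heis β) :
    (Heis β → ℬ) →ₗ[ℬ] (Heis β → ℬ) where
  toFun f := fun h => f (h * h₀)
  map_add' _ _ := rfl
  map_smul' _ _ := rfl

lemma hAct_mem (β : W →ₗ[F] W →ₗ[F] F) (ℬ : Type*) [CommRing ℬ] (A : AddSubgroup W)
    (χ : Heis β → ℬˣ) (h₀ : Heis β) (f : Heis β → ℬ) (hf : f ∈ IndV β ℬ A χ) :
    hAct β ℬ h₀ f ∈ IndV β ℬ A χ := by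
  intro a ha h
  simpa [hAct, mul_assoc] using hf a ha (h * h₀)

/-- The action `ρ` of the Heisenberg group on `V_A^ℬ`. -/
def hActV (β : W →ₗ[F] W →ₗ[F] F) (ℬ : Type*) [CommRing ℬ] (A : AddSubgroup W)
    (χ : Heis β → ℬˣ) (h₀ : Heis β) :
    ↥(IndV β ℬ A χ) →ₗ[ℬ] ↥(IndV β ℬ A χ) :=
  (hAct β ℬ h₀).restrict fun f hf => hAct_mem β ℬ A χ h₀ f hf

/-! ## The symplectic group and its action on the Heisenberg group -/

/-- Action of a linear automorphism `g` on the Heisenberg group: `g·(w,t) = (gw,t)`. -/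
def gHeis (β : W →ₗ[F] W →ₗ[F] F) (g : W ≃ₗ[F] W) : Heis β → Heis β :=
  fun h => ⟨g h.w, h.t⟩

/-- The symplectic group `Sp(W)` of the form `β`, as a subgroup of the linear
automorphism group of `W`. -/
def SpGrp (β : W →ₗ[F] W →ₗ[F] F) : Subgroup (W ≃ₗ[F] W) where
  carrier := {g | ∀ u v : W, β (g u) (g v) = β u v}
  one_mem' := fun _ _ => rfl
  mul_mem' := by
    intro g g' hg hg' u v
    have h : ∀ x, (g * g') x = g (g' x) := fun _ => rfl
    rw [h, h, hg, hg']
  inv_mem' := by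
    intro g hg u v
    have h1 := hg (g⁻¹ u) (g⁻¹ v)
    have h2 : ∀ x, g (g⁻¹ x) = x := fun x => g.apply_symm_apply x
    rw [h2, h2] at h1
    exact h1.symm

/-- The defining condition of the metaplectic group over `ℬ` : pairs `(g, M)` with
`g ∈ Sp(W)` and `M ∘ ρ(h) = ρ(g·h) ∘ M` for all `h ∈ H`. -/
def MetaCond (β : W →ₗ[F] W →ₗ[F] F) (ℬ : Type*) [CommRing ℬ] (A : AddSubgroup W)
    (χ : Heis β → ℬˣ)
    (x : (W ≃ₗ[F] W) × (↥(IndV β ℬ A χ) ≃ₗ[ℬ] ↥(IndV β ℬ A χ))) : Prop :=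
  (∀ u v : W, β (x.1 u) (x.1 v) = β u v) ∧
    ∀ (h₀ : Heis β) (f : ↥(IndV β ℬ A χ)),
      x.2 (hActV β ℬ A χ h₀ f) = hActV β ℬ A χ (gHeis β x.1 h₀) (x.2 f)

/-- The character `ψ_A^ℬ = φ ∘ ψ_A` of `A_H` with values in `ℬˣ`, obtained from a
character with values in `𝒜ˣ` via the structure morphism `φ : 𝒜 → ℬ`. -/
def chB (p : ℕ+) (ℬ : Type*) [CommRing ℬ] [Algebra (AA p) ℬ]
    {β : W →ₗ[F] W →ₗ[F] F} (ψA : Heis β → (AA p)ˣ) : Heis β → ℬˣ :=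
  fun h => Units.map (algebraMap (AA p) ℬ).toMonoidHom (ψA h)

/-- The character `ψ^ℬ = φ ∘ ψ` of `F` with values in `ℬˣ`. -/
def psB (p : ℕ+) (ℬ : Type*) [CommRing ℬ] [Algebra (AA p) ℬ]
    (ψ : F → (AA p)ˣ) : F → ℬˣ :=
  fun t => Units.map (algebraMap (AA p) ℬ).toMonoidHom (ψ t)

/-- The map `φ_ℬ : GL_𝒜(V_A^𝒜) → GL_ℬ(V_A^ℬ)` induced by extension of scalars along
`φ : 𝒜 → ℬ` together with the canonical identification `e : V_A^𝒜 ⊗_𝒜 ℬ ≅ V_A^ℬ`. -/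
def phiB (p : ℕ+) [Fact (Nat.Prime (p : ℕ))]
    {F : Type*} [Field F] {W : Type*} [AddCommGroup W] [Module F W]
    (β : W →ₗ[F] W →ₗ[F] F)
    (ℬ : Type*) [CommRing ℬ] [Algebra (AA p) ℬ] (A : AddSubgroup W)
    (ψA : Heis β → (AA p)ˣ)
    (e : (ℬ ⊗[AA p] ↥(IndV β (AA p) A ψA)) ≃ₗ[ℬ] ↥(IndV β ℬ A (chB p ℬ ψA)))
    (M : ↥(IndV β (AA p) A ψA) ≃ₗ[AA p] ↥(IndV β (AA p) A ψA)) :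
    ↥(IndV β ℬ A (chB p ℬ ψA)) ≃ₗ[ℬ] ↥(IndV β ℬ A (chB p ℬ ψA)) :=
  (e.symm.trans (LinearEquiv.baseChange (AA p) ℬ _ _ M)).trans e

instance AA.instIsDomain (p : ℕ+) : IsDomain (AA p) := by
  with_unfolding_all exact (inferInstance : IsDomain ↥(Aint (p : ℕ) p))

instance AA.instCharZero (p : ℕ+) : CharZero (AA p) := by
  have h : CharZero ↥(Aint (p : ℕ) p) :=
    ⟨fun m n hmn => Nat.cast_injective (R := CyclotomicField p ℚ)
      (by simpa using congrArg Subtype.val hmn)⟩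
  with_unfolding_all exact h

@[simp] lemma hActV_apply (β : W →ₗ[F] W →ₗ[F] F) (R : Type*) [CommRing R] (A : AddSubgroup W)
    (χ : Heis β → Rˣ) (h₀ : Heis β) (f : ↥(IndV β R A χ)) (h : Heis β) :
    (hActV β R A χ h₀ f : Heis β → R) h = (f : Heis β → R) (h * h₀) := rfl

/-- The sum of `ψ ⟨v, a⟩` over a finite subgroup `A` vanishes once one term differs from `1`. -/
lemma sum_char_pairing_eq_zero {R : Type*} [CommRing R] [IsDomain R]
    (β : W →ₗ[F] W →ₗ[F] F) (A : AddSubgroup W) [Fintype A] (ψ : F → Rˣ)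
    (hψ : ∀ x y : F, ψ (x + y) = ψ x * ψ y) (v : W) (a₀ : A) (ha₀ : ψ (β v a₀) ≠ 1) :
    ∑ a : A, (ψ (β v a) : R) = 0 := by
  have key : (ψ (β v a₀) : R) * ∑ a : A, (ψ (β v a) : R) = ∑ a : A, (ψ (β v a) : R) := by
    rw [Finset.mul_sum, ← Equiv.sum_comp (Equiv.addLeft a₀) fun a : A => (ψ (β v a) : R)]
    refine Finset.sum_congr rfl fun a _ => ?_
    simp [hψ]
  have hne : (ψ (β v a₀) : R) - 1 ≠ 0 := fun h => ha₀ (Units.ext (sub_eq_zero.mp h))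
  refine (mul_eq_zero.mp ?_).resolve_left hne
  rw [sub_mul, one_mul, key, sub_self]

section Schur

variable {R : Type*} [CommRing R] {β : W →ₗ[F] W →ₗ[F] F} {A : AddSubgroup W}
  {χ : Heis β → Rˣ}

open scoped Classical in
/-- The function supported on `A_H` whose restriction to `A_H` is the character `χ`. -/
def IndV.delta (hχ : ∀ a b : Heis β, a.w ∈ A → b.w ∈ A → χ (a * b) = χ a * χ b) :
    ↥(IndV β R A χ) :=
  ⟨fun h => if h.w ∈ A then (χ h : R) else 0, by
    intro a ha h
    by_cases hh : h.w ∈ A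
    · simp [hh, A.add_mem ha hh, hχ a h ha hh]
    · simp [hh, A.add_mem_cancel_left ha]⟩

lemma char_one (hχ : ∀ a b : Heis β, a.w ∈ A → b.w ∈ A → χ (a * b) = χ a * χ b) :
    χ 1 = 1 := by
  simpa using hχ 1 1 A.zero_mem A.zero_mem

lemma IndV.delta_one (hχ : ∀ a b : Heis β, a.w ∈ A → b.w ∈ A → χ (a * b) = χ a * χ b) :
    (IndV.delta hχ : Heis β → R) 1 = 1 := by
  simp [IndV.delta, char_one hχ]

/-- Averaging over `A` against `χ⁻¹`. -/
def IndV.average [Fintype A] (f : ↥(IndV β R A χ)) : ↥(IndV β R A χ) :=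
  ∑ a : A, ((χ ⟨a, 0⟩)⁻¹ : Rˣ).val • hActV β R A χ ⟨a, 0⟩ f

/-- Right translation by `a ∈ A` multiplies `f(h)` by `χ(a) ψ(⟨h, a⟩)`. -/
lemma IndV.apply_mul (h2 : (2 : F) ≠ 0) (halt : ∀ v : W, β v v = 0) (ψ : F → Rˣ)
    (hχ : ∀ a b : Heis β, a.w ∈ A → b.w ∈ A → χ (a * b) = χ a * χ b)
    (hχψ : ∀ t : F, χ ⟨0, t⟩ = ψ t) (f : ↥(IndV β R A χ)) (a : A) (h : Heis β) :
    (f : Heis β → R) (h * ⟨a, 0⟩) =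
      (χ ⟨a, 0⟩ : R) * (ψ (β h.w a) : R) * (f : Heis β → R) h := by
  have hswap : β (a : W) h.w = -β h.w (a : W) := (LinearMap.IsAlt.neg halt h.w a).symm
  have hcomm : h * ⟨a, 0⟩ = (⟨a, 0⟩ * ⟨0, β h.w a⟩ : Heis β) * h := by
    ext
    · simp [add_comm]
    · simp only [Heis.mul_t, Heis.mul_w, map_zero, add_zero, mul_zero, zero_add, hswap]
      field_simp
      ring
  rw [hcomm, f.2 _ (by simp) h, hχ _ _ a.2 A.zero_mem, hχψ]
  simp

lemma IndV.average_eq [IsDomain R] [Fintype A] (h2 : (2 : F) ≠ 0)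
    (halt : ∀ v : W, β v v = 0) (ψ : F → Rˣ) (hψ : ∀ x y : F, ψ (x + y) = ψ x * ψ y)
    (hA : ∀ v : W, (∀ a ∈ A, ψ (β v a) = 1) ↔ v ∈ A)
    (hχ : ∀ a b : Heis β, a.w ∈ A → b.w ∈ A → χ (a * b) = χ a * χ b)
    (hχψ : ∀ t : F, χ ⟨0, t⟩ = ψ t) (f : ↥(IndV β R A χ)) :
    IndV.average f = ((Fintype.card A : R) * (f : Heis β → R) 1) • IndV.delta hχ := by
  ext h
  have hsum : (IndV.average f : Heis β → R) h
      = (∑ a : A, (ψ (β h.w a) : R)) * (f : Heis β → R) h := by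
    simp only [IndV.average, Submodule.coe_sum, Submodule.coe_smul, Finset.sum_apply,
      Pi.smul_apply, smul_eq_mul, hActV_apply, Finset.sum_mul]
    refine Finset.sum_congr rfl fun a _ => ?_
    rw [IndV.apply_mul h2 halt ψ hχ hχψ, ← mul_assoc, ← mul_assoc, Units.inv_mul, one_mul]
  rw [hsum]
  by_cases hh : h.w ∈ A
  · have hf := f.2 h hh 1
    rw [mul_one] at hf
    have hone : ∀ a : A, ψ (β h.w a) = 1 := fun a => (hA h.w).mpr hh a a.2
    simp [hone, hf, IndV.delta, hh]
    ring
  · obtain ⟨a, ha, hne⟩ : ∃ a ∈ A, ψ (β h.w a) ≠ 1 := by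
      by_contra! hall
      exact hh ((hA h.w).mp hall)
    rw [sum_char_pairing_eq_zero β A ψ hψ h.w ⟨a, ha⟩ hne]
    simp [IndV.delta, hh]

/-- Schur's lemma: an `H`-equivariant endomorphism of `V_A` is a scalar. -/
lemma IndV.eq_smul_of_commutes [IsDomain R] [CharZero R] [Finite A] (h2 : (2 : F) ≠ 0)
    (halt : ∀ v : W, β v v = 0) (ψ : F → Rˣ) (hψ : ∀ x y : F, ψ (x + y) = ψ x * ψ y)
    (hA : ∀ v : W, (∀ a ∈ A, ψ (β v a) = 1) ↔ v ∈ A)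
    (hχ : ∀ a b : Heis β, a.w ∈ A → b.w ∈ A → χ (a * b) = χ a * χ b)
    (hχψ : ∀ t : F, χ ⟨0, t⟩ = ψ t) (M : ↥(IndV β R A χ) →ₗ[R] ↥(IndV β R A χ))
    (hM : ∀ h f, M (hActV β R A χ h f) = hActV β R A χ h (M f)) (f : ↥(IndV β R A χ)) :
    M f = (M (IndV.delta hχ) : Heis β → R) 1 • f := by
  have := Fintype.ofFinite A
  have hcard : (Fintype.card A : R) ≠ 0 := Nat.cast_ne_zero.mpr Fintype.card_ne_zero
  have at_one : ∀ f : ↥(IndV β R A χ), (M f : Heis β → R) 1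
      = (M (IndV.delta hχ) : Heis β → R) 1 * (f : Heis β → R) 1 := by
    intro f
    have hcomm : M (IndV.average f) = IndV.average (M f) := by
      simp only [IndV.average, map_sum, map_smul, hM]
    rw [IndV.average_eq h2 halt ψ hψ hA hχ hχψ, IndV.average_eq h2 halt ψ hψ hA hχ hχψ,
      map_smul] at hcomm
    have hval := congrFun (congrArg Subtype.val hcomm) 1
    simp only [Submodule.coe_smul, Pi.smul_apply, smul_eq_mul, IndV.delta_one, mul_one,
      mul_assoc] at hval
    rw [← mul_left_cancel₀ hcard hval, mul_comm]
  ext h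
  have hval := at_one (hActV β R A χ h f)
  rw [hM] at hval
  simpa using hval

end Schur

section BaseChange

variable {p : ℕ+} {β : W →ₗ[F] W →ₗ[F] F} {ℬ : Type*} [CommRing ℬ]
  [Algebra (AA p) ℬ] {A : AddSubgroup W} {ψA : Heis β → (AA p)ˣ}
  (e : (ℬ ⊗[AA p] ↥(IndV β (AA p) A ψA)) ≃ₗ[ℬ] ↥(IndV β ℬ A (chB p ℬ ψA)))

lemma hActV_apply_tmul
    (he : ∀ (b : ℬ) (f : ↥(IndV β (AA p) A ψA)),
      ((e (b ⊗ₜ[AA p] f) : Heis β → ℬ)) =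
        fun h => b * algebraMap (AA p) ℬ ((f : Heis β → AA p) h))
    (h₀ : Heis β) (b : ℬ) (f : ↥(IndV β (AA p) A ψA)) :
    hActV β ℬ A (chB p ℬ ψA) h₀ (e (b ⊗ₜ f)) = e (b ⊗ₜ hActV β (AA p) A ψA h₀ f) := by
  ext h
  simp [he]

/-- Linear maps out of `V_A^ℬ` agree once they agree on the images of pure tensors. -/
lemma linearMap_ext_tmul {N : Type*} [AddCommGroup N] [Module ℬ N]
    {S T : ↥(IndV β ℬ A (chB p ℬ ψA)) →ₗ[ℬ] N}
    (h : ∀ (b : ℬ) (f : ↥(IndV β (AA p) A ψA)), S (e (b ⊗ₜ f)) = T (e (b ⊗ₜ f))) : S = T := by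
  ext y
  obtain ⟨z, rfl⟩ := e.surjective y
  induction z with
  | zero => simp
  | tmul b f => exact h b f
  | add z z' hz hz' => rw [map_add, map_add, map_add, hz, hz']

variable [Fact (Nat.Prime (p : ℕ))]

lemma phiB_apply_tmul (M : ↥(IndV β (AA p) A ψA) ≃ₗ[AA p] ↥(IndV β (AA p) A ψA)) (b : ℬ)
    (f : ↥(IndV β (AA p) A ψA)) :
    phiB p β ℬ A ψA e M (e (b ⊗ₜ f)) = e (b ⊗ₜ M f) := by
  simp [phiB]

lemma phiB_mul (M M' : ↥(IndV β (AA p) A ψA) ≃ₗ[AA p] ↥(IndV β (AA p) A ψA)) :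
    phiB p β ℬ A ψA e (M * M') = phiB p β ℬ A ψA e M * phiB p β ℬ A ψA e M' := by
  apply LinearEquiv.toLinearMap_injective
  refine linearMap_ext_tmul e fun b f => ?_
  simp [LinearEquiv.mul_apply, phiB_apply_tmul]

lemma MetaCond.phiB
    (he : ∀ (b : ℬ) (f : ↥(IndV β (AA p) A ψA)),
      ((e (b ⊗ₜ[AA p] f) : Heis β → ℬ)) =
        fun h => b * algebraMap (AA p) ℬ ((f : Heis β → AA p) h))
    {x : (W ≃ₗ[F] W) × (↥(IndV β (AA p) A ψA) ≃ₗ[AA p] ↥(IndV β (AA p) A ψA))}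
    (hx : MetaCond β (AA p) A ψA x) :
    MetaCond β ℬ A (chB p ℬ ψA) (x.1, phiB p β ℬ A ψA e x.2) := by
  refine ⟨hx.1, fun h₀ y => ?_⟩
  have hcomp : (_root_.phiB p β ℬ A ψA e x.2).toLinearMap ∘ₗ hActV β ℬ A (chB p ℬ ψA) h₀ =
      hActV β ℬ A (chB p ℬ ψA) (gHeis β x.1 h₀) ∘ₗ
        (_root_.phiB p β ℬ A ψA e x.2).toLinearMap := by
    refine linearMap_ext_tmul e fun b f => ?_
    simp only [LinearMap.comp_apply, LinearEquiv.coe_coe, phiB_apply_tmul,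
      hActV_apply_tmul e he, hx.2]
  exact LinearMap.congr_fun hcomp y

end BaseChange

/-- The map `φ̃_ℬ : (g,M) ↦ (g, φ_ℬ(M))` sends `S̃p_A^𝒜(W)` into
`S̃p_A^ℬ(W)`, is a group homomorphism commuting with the projections to `Sp(W)`, and
its kernel is `{(id, λ·id) : λ ∈ 𝒜ˣ, φ(λ) = 1}`, the kernel of `𝒜ˣ → ℬˣ`. -/
theorem statement_7
    (p : ℕ+) [Fact (Nat.Prime (p : ℕ))] (hp2 : (p : ℕ) ≠ 2)
    {F : Type*} [Field F] [Fintype F] [CharP F (p : ℕ)]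
    {W : Type*} [AddCommGroup W] [Module F W] [FiniteDimensional F W]
    (β : W →ₗ[F] W →ₗ[F] F)
    (halt : ∀ v : W, β v v = 0)
    (hnd : ∀ v : W, (∀ u : W, β v u = 0) → v = 0)
    (ℬ : Type*) [CommRing ℬ] [Algebra (AA p) ℬ]
    (ψ : F → (AA p)ˣ) (hψ : ∀ x y : F, ψ (x + y) = ψ x * ψ y)
    (hψnt : ∃ x : F, ψ x ≠ 1)
    (A : AddSubgroup W)
    (hA : ∀ v : W, (∀ a ∈ A, ψ (β v a) = 1) ↔ v ∈ A)
    (ψA : Heis β → (AA p)ˣ)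
    (hψA : ∀ a b : Heis β, a.w ∈ A → b.w ∈ A → ψA (a * b) = ψA a * ψA b)
    (hψAext : ∀ t : F, ψA ⟨0, t⟩ = ψ t)
    (e : (ℬ ⊗[AA p] ↥(IndV β (AA p) A ψA)) ≃ₗ[ℬ] ↥(IndV β ℬ A (chB p ℬ ψA)))
    (he : ∀ (b : ℬ) (f : ↥(IndV β (AA p) A ψA)),
      ((e (b ⊗ₜ[AA p] f) : Heis β → ℬ)) =
        fun h => b * algebraMap (AA p) ℬ ((f : Heis β → AA p) h)) :
    -- `φ̃_ℬ` sends the metaplectic group over `𝒜` into the one over `ℬ`,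
    -- commuting with the projections to `Sp(W)` by construction
    (∀ x : (W ≃ₗ[F] W) × (↥(IndV β (AA p) A ψA) ≃ₗ[AA p] ↥(IndV β (AA p) A ψA)),
      MetaCond β (AA p) A ψA x →
        MetaCond β ℬ A (chB p ℬ ψA) (x.1, phiB p β ℬ A ψA e x.2)) ∧
    -- it is multiplicative
    (∀ M M' : ↥(IndV β (AA p) A ψA) ≃ₗ[AA p] ↥(IndV β (AA p) A ψA),
      phiB p β ℬ A ψA e (M * M') = phiB p β ℬ A ψA e M * phiB p β ℬ A ψA e M') ∧
    -- its kernel is the kernel of `𝒜ˣ → ℬˣ`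
    (∀ x : (W ≃ₗ[F] W) × (↥(IndV β (AA p) A ψA) ≃ₗ[AA p] ↥(IndV β (AA p) A ψA)),
      MetaCond β (AA p) A ψA x →
      ((x.1 = 1 ∧ phiB p β ℬ A ψA e x.2 = 1) ↔
        (x.1 = 1 ∧ ∃ lam : (AA p)ˣ, algebraMap (AA p) ℬ lam = 1 ∧
          ∀ f : ↥(IndV β (AA p) A ψA), x.2 f = (lam : AA p) • f))) := by
  refine ⟨fun x hx => hx.phiB e he, phiB_mul e, ?_⟩
  rintro ⟨g, M⟩ hx
  refine and_congr_right fun hg => ⟨fun hker => ?_, ?_⟩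
  · obtain rfl : g = 1 := hg
    have h2 : (2 : F) ≠ 0 := Ring.two_ne_zero (by rwa [ringChar.eq F (p : ℕ)])
    have : Finite W := Module.finite_of_finite F
    have hscalar := IndV.eq_smul_of_commutes h2 halt ψ hψ hA hψA hψAext M.toLinearMap
      fun h f => hx.2 h f
    set lam := (M.toLinearMap (IndV.delta hψA) : Heis β → AA p) 1 with hlam
    have hunit : IsUnit lam := by
      obtain ⟨f, hf⟩ := M.surjective (IndV.delta hψA)
      have hval := congrFun (congrArg Subtype.val ((hscalar f).symm.trans hf)) 1
      rw [IndV.delta_one] at hval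
      exact IsUnit.of_mul_eq_one _ hval
    refine ⟨hunit.unit, ?_, hscalar⟩
    have hfix := phiB_apply_tmul e M 1 (IndV.delta hψA)
    have hker' : phiB p β ℬ A ψA e M = 1 := hker
    rw [hker'] at hfix
    have hval := congrFun (congrArg Subtype.val hfix) 1
    simpa [he, IndV.delta_one, hlam, eq_comm] using hval
  · rintro ⟨lam, hlam, hM⟩
    apply LinearEquiv.toLinearMap_injective
    refine linearMap_ext_tmul e fun b f => ?_
    have hMf : M f = (lam : AA p) • f := hM f
    have hsmul : b ⊗ₜ[AA p] ((lam : AA p) • f) = b ⊗ₜ[AA p] f := by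
      rw [← TensorProduct.smul_tmul, Algebra.smul_def, hlam, one_mul]
    simp [phiB_apply_tmul, hMf, hsmul, -TensorProduct.tmul_smul]
end
end

section
/- Let X be a Lagrangian of W (a maximal totally isotropic F-subspace); X is self-dual. Then the metaplectic central extension splits: there exists a group homomorphism ω : Sp(W) → GL_ℬ(V_X^ℬ) such that ω(g) ∘ ρ(h) ∘ ω(g)^{-1} = ρ(g·h) for all g ∈ Sp(W) and h ∈ H. (Equivalently, over a finite field the 2-cocycle of the Weil representation is trivial: the section g ↦ (g, ω(g)) is a group homomorphism Sp(W) → S̃p_X^ℬ(W) splitting the projection.) -/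
set_option maxHeartbeats 1000000
set_option synthInstance.maxHeartbeats 1000000

noncomputable section

open scoped TensorProduct

/-! ## The Heisenberg group -/

variable {F : Type*} [Field F] {W : Type*} [AddCommGroup W] [Module F W]

/-! ## Symplectic transvections generate the symplectic group -/

section Transvections

variable {β : W →ₗ[F] W →ₗ[F] F}

lemma alternating_neg (halt : ∀ v : W, β v v = 0) (u v : W) : β u v = -β v u := by
  have h := halt (u + v)
  simp only [map_add, LinearMap.add_apply, halt] at h
  linear_combination h

/-- The symplectic transvection `x ↦ x + c ⟨x, u⟩ u`. -/
def spTransvection (halt : ∀ v : W, β v v = 0) (c : F) (u : W) : W ≃ₗ[F] W :=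
  LinearEquiv.transvection (f := c • β.flip u) (v := u) (by simp [halt])

lemma spTransvection_apply (halt : ∀ v : W, β v v = 0) (c : F) (u x : W) :
    spTransvection halt c u x = x + (c * β x u) • u := by
  simp [spTransvection, LinearMap.transvection.apply]

lemma spTransvection_isometry (halt : ∀ v : W, β v v = 0) (c : F) (u x y : W) :
    β (spTransvection halt c u x) (spTransvection halt c u y) = β x y := by
  simp only [spTransvection_apply, map_add, map_smul, LinearMap.add_apply, LinearMap.smul_apply,
    smul_eq_mul, halt]
  rw [alternating_neg halt u y]
  ring

lemma spTransvection_fix (halt : ∀ v : W, β v v = 0) {g : W ≃ₗ[F] W}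
    (hg : ∀ u v : W, β (g u) (g v) = β u v) (c : F) (v x : W) (hx : g x = x) :
    spTransvection halt c (g v - v) (g x) = x := by
  have h := hg x v
  rw [hx] at h
  simp [spTransvection_apply, hx, h]

lemma spTransvection_move (halt : ∀ v : W, β v v = 0) (g : W ≃ₗ[F] W) (v : W)
    (hv : β (g v) v ≠ 0) :
    spTransvection halt (β (g v) v)⁻¹ (g v - v) (g v) = v := by
  simp [spTransvection_apply, halt, hv]

/-- A subgroup containing all symplectic transvections contains every isometry. -/
theorem mem_of_spTransvection_mem [FiniteDimensional F W] (halt : ∀ v : W, β v v = 0)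
    (hnd : ∀ v : W, (∀ u : W, β v u = 0) → v = 0) (K : Subgroup (W ≃ₗ[F] W))
    (hK : ∀ c : F, c ≠ 0 → ∀ u : W, spTransvection halt c u ∈ K)
    (g : W ≃ₗ[F] W) (hg : ∀ u v : W, β (g u) (g v) = β u v) : g ∈ K := by
  let Fix : (W ≃ₗ[F] W) → Submodule F W := fun g => LinearMap.eqLocus (g : W →ₗ[F] W) LinearMap.id
  have hFix : ∀ (g : W ≃ₗ[F] W) (x : W), x ∈ Fix g ↔ g x = x := fun g x => Iff.rfl
  have key : ∀ (S : Submodule F W) (g : W ≃ₗ[F] W), (∀ u v : W, β (g u) (g v) = β u v) →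
      Fix g = S → g ∈ K := by
    intro S
    induction S using WellFoundedGT.induction with
    | ind S ih =>
    have grow : ∀ g : W ≃ₗ[F] W, (∀ u v : W, β (g u) (g v) = β u v) → S ≤ Fix g →
        (∃ v, β (g v) v ≠ 0) → g ∈ K := by
      rintro g hg hS ⟨v, hv⟩
      set τ := spTransvection halt (β (g v) v)⁻¹ (g v - v) with hτ
      have hτK : τ ∈ K := hK _ (inv_ne_zero hv) _
      refine (K.mul_mem_cancel_left hτK).mp (ih (Fix (τ * g)) ?_ (τ * g) ?_ rfl)
      · refine lt_of_le_of_ne (fun x hx => spTransvection_fix halt hg _ v x (hS hx)) ?_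
        intro h
        have hvS : v ∈ S := by
          rw [h]
          exact spTransvection_move halt g v hv
        have : g v = v := hS hvS
        exact hv (by rw [this, halt])
      · intro x y
        exact (spTransvection_isometry halt _ _ _ _).trans (hg x y)
    intro g hg hS
    by_cases hex : ∃ v, β (g v) v ≠ 0
    · exact grow g hg hS.ge hex
    push Not at hex
    by_cases h1 : ∀ v, g v = v
    · have : g = 1 := LinearEquiv.ext h1
      exact this ▸ K.one_mem
    push Not at h1
    obtain ⟨v, hv⟩ := h1
    obtain ⟨z, hz⟩ : ∃ z, β (g v - v) z ≠ 0 := by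
      by_contra! h
      exact hv (sub_eq_zero.mp (hnd _ h))
    have hτK := hK 1 one_ne_zero (g v - v)
    refine (K.mul_mem_cancel_left hτK).mp (grow _ ?_ ?_ ⟨z, ?_⟩)
    · intro x y
      exact (spTransvection_isometry halt _ _ _ _).trans (hg x y)
    · intro x hx
      rw [← hS] at hx
      exact spTransvection_fix halt hg _ v x hx
    · change β (spTransvection halt 1 (g v - v) (g z)) z ≠ 0
      have hpol : β (g z) v = -β (g v) z := by
        have h := hex (z + v)
        simp only [map_add, LinearMap.add_apply, hex] at h
        linear_combination h
      have hgz : β (g z) (g v - v) = β (g v - v) z := by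
        rw [map_sub, hg, hpol, map_sub, LinearMap.sub_apply, alternating_neg halt z v]
        ring
      rw [spTransvection_apply, hgz]
      simpa [hex] using hz
  exact key _ g hg rfl

end Transvections

/-! ## Implementing isometries on a representation of the Heisenberg group -/

section Implement

variable {β : W →ₗ[F] W →ₗ[F] F} {ℬ : Type*} [CommRing ℬ] {V : Type*} [AddCommGroup V] [Module ℬ V]

/-- The linear automorphisms of `W` which are implemented on the representation `ρ`. -/
def implementable (ρ : Heis β →* Module.End ℬ V) : Subgroup (W ≃ₗ[F] W) where
  carrier := {g | ∃ M : V ≃ₗ[ℬ] V, ∀ h v, M (ρ h v) = ρ (gHeis β g h) (M v)}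
  one_mem' := ⟨1, fun _ _ => rfl⟩
  mul_mem' := by
    rintro g g' ⟨M, hM⟩ ⟨M', hM'⟩
    refine ⟨M * M', fun h v => ?_⟩
    change M (M' _) = ρ (gHeis β g (gHeis β g' h)) (M (M' v))
    rw [hM', hM]
  inv_mem' := by
    rintro g ⟨M, hM⟩
    refine ⟨M.symm, fun h v => ?_⟩
    rw [LinearEquiv.symm_apply_eq, hM, LinearEquiv.apply_symm_apply]
    congr 2
    ext
    · exact (g.apply_symm_apply h.w).symm
    · rfl

lemma rho_mk {ρ : Heis β →* Module.End ℬ V} {e : AddChar F ℬ}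
    (hρ : ∀ t, ρ ⟨0, t⟩ = e t • (1 : Module.End ℬ V)) (w : W) (t : F) :
    ρ ⟨w, t⟩ = e t • ρ ⟨w, 0⟩ := by
  have : (⟨w, t⟩ : Heis β) = ⟨0, t⟩ * ⟨w, 0⟩ := by ext <;> simp
  rw [this, map_mul, hρ, smul_mul_assoc, one_mul]

variable [Fintype F]

/-- The quadratic Gauss operator `∑ₜ ψ(a t²) ρ(t u)`. -/
def gaussOp (ρ : Heis β →* Module.End ℬ V) (e : AddChar F ℬ) (u : W) (a : F) : Module.End ℬ V :=
  ∑ t : F, e (a * t ^ 2) • ρ ⟨t • u, 0⟩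

lemma gaussOp_mul_neg (halt : ∀ v : W, β v v = 0) {ρ : Heis β →* Module.End ℬ V}
    {e : AddChar F ℬ} (hρ : ∀ t, ρ ⟨0, t⟩ = e t • (1 : Module.End ℬ V))
    (hsum : ∀ b : F, b ≠ 0 → ∑ t, e (b * t) = 0) (h2 : (2 : F) ≠ 0)
    (u : W) {a : F} (ha : a ≠ 0) :
    gaussOp ρ e u a * gaussOp ρ e u (-a) = (Fintype.card F : ℬ) • 1 := by
  have hmul : ∀ s t : F, ρ ⟨s • u, 0⟩ * ρ ⟨t • u, 0⟩ = ρ ⟨(s + t) • u, 0⟩ := by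
    intro s t
    rw [← map_mul]
    congr 1
    ext <;> simp [add_smul, halt]
  calc gaussOp ρ e u a * gaussOp ρ e u (-a)
      = ∑ s, ∑ t, e (a * s ^ 2 - a * t ^ 2) • ρ ⟨(s + t) • u, 0⟩ := by
        rw [gaussOp, gaussOp, Finset.sum_mul_sum]
        refine Finset.sum_congr rfl fun s _ => Finset.sum_congr rfl fun t _ => ?_
        rw [smul_mul_smul_comm, hmul, ← AddChar.map_add_eq_mul]
        congr 2
        ring
    _ = ∑ s, ∑ r, e (2 * a * r * s) • e (-a * r ^ 2) • ρ ⟨r • u, 0⟩ := by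
        refine Finset.sum_congr rfl fun s _ => ?_
        refine Fintype.sum_equiv (Equiv.addLeft s) _ _ fun t => ?_
        rw [smul_smul, ← AddChar.map_add_eq_mul, Equiv.coe_addLeft]
        congr 2
        ring
    _ = ∑ r, (∑ s, e (2 * a * r * s)) • e (-a * r ^ 2) • ρ ⟨r • u, 0⟩ := by
        rw [Finset.sum_comm]
        simp_rw [Finset.sum_smul]
    _ = (Fintype.card F : ℬ) • 1 := by
        rw [Fintype.sum_eq_single 0]
        · simp [hρ]
        · intro r hr
          rw [hsum _ (mul_ne_zero (mul_ne_zero h2 ha) hr), zero_smul]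

lemma gaussOp_intertwines (halt : ∀ v : W, β v v = 0) {ρ : Heis β →* Module.End ℬ V}
    {e : AddChar F ℬ} (hρ : ∀ t, ρ ⟨0, t⟩ = e t • (1 : Module.End ℬ V)) (h2 : (2 : F) ≠ 0)
    {c : F} (hc : c ≠ 0) (u : W) (h : Heis β) :
    gaussOp ρ e u (2 * c)⁻¹ * ρ h =
      ρ (gHeis β (spTransvection halt c u) h) * gaussOp ρ e u (2 * c)⁻¹ := by
  obtain ⟨w, r⟩ := h
  rw [gaussOp, Finset.sum_mul, Finset.mul_sum]
  refine (Fintype.sum_equiv (Equiv.addRight (c * β w u)) _ _ fun s => ?_).symm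
  rw [smul_mul_assoc, mul_smul_comm, ← map_mul, ← map_mul, Equiv.coe_addRight]
  have e1 : (gHeis β (spTransvection halt c u) ⟨w, r⟩ * ⟨s • u, 0⟩ : Heis β) =
      ⟨(s + c * β w u) • u + w, r + 2⁻¹ * (s * β w u)⟩ := by
    ext
    · simp only [gHeis, spTransvection_apply, Heis.mul_w, add_smul]
      abel
    · simp [gHeis, spTransvection_apply, halt]
  have e2 : (⟨(s + c * β w u) • u, 0⟩ * ⟨w, r⟩ : Heis β) =
      ⟨(s + c * β w u) • u + w, r - 2⁻¹ * ((s + c * β w u) * β w u)⟩ := by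
    ext
    · simp
    · simp only [Heis.mul_t, map_smul, LinearMap.smul_apply, smul_eq_mul,
        alternating_neg halt u w]
      ring
  rw [e1, e2, rho_mk hρ, rho_mk hρ _ (r - _), smul_smul, smul_smul, ← AddChar.map_add_eq_mul,
    ← AddChar.map_add_eq_mul]
  congr 2
  field_simp
  ring

lemma spTransvection_mem_implementable (halt : ∀ v : W, β v v = 0)
    {ρ : Heis β →* Module.End ℬ V} {e : AddChar F ℬ}
    (hρ : ∀ t, ρ ⟨0, t⟩ = e t • (1 : Module.End ℬ V))
    (hsum : ∀ b : F, b ≠ 0 → ∑ t, e (b * t) = 0) (h2 : (2 : F) ≠ 0)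
    (hq : IsUnit (Fintype.card F : ℬ)) (c : F) (hc : c ≠ 0) (u : W) :
    spTransvection halt c u ∈ implementable ρ := by
  obtain ⟨q, hq⟩ := hq
  set a : F := (2 * c)⁻¹ with ha
  have ha0 : a ≠ 0 := inv_ne_zero (mul_ne_zero h2 hc)
  have h₁ := gaussOp_mul_neg halt hρ hsum h2 u ha0
  have h₂ := gaussOp_mul_neg halt hρ hsum h2 u (neg_ne_zero.mpr ha0)
  rw [neg_neg] at h₂
  have hinv : ((q⁻¹ : ℬˣ) : ℬ) • (Fintype.card F : ℬ) • (1 : Module.End ℬ V) = 1 := by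
    rw [← hq, smul_smul, Units.inv_mul, one_smul]
  refine ⟨LinearEquiv.ofLinearMap (gaussOp ρ e u a) (((q⁻¹ : ℬˣ) : ℬ) • gaussOp ρ e u (-a)) ?_ ?_,
    fun h v => ?_⟩
  · change gaussOp ρ e u a * (((q⁻¹ : ℬˣ) : ℬ) • gaussOp ρ e u (-a)) = 1
    rw [mul_smul_comm, h₁, hinv]
  · change (((q⁻¹ : ℬˣ) : ℬ) • gaussOp ρ e u (-a)) * gaussOp ρ e u a = 1
    rw [smul_mul_assoc, h₂, hinv]
  · exact LinearMap.congr_fun (gaussOp_intertwines halt hρ h2 hc u h) v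

end Implement

/-! ## A degree one multiplicative functional on operators commuting with the reflection -/

section Reflection

variable (Y : Type*) [AddCommGroup Y] (ℬ : Type*) [CommRing ℬ]

/-- The reflection `φ ↦ φ(-·)` of the space of functions on `Y`. -/
def reflection : (Y → ℬ) ≃ₗ[ℬ] (Y → ℬ) := LinearEquiv.funCongrLeft ℬ ℬ (Equiv.neg Y)

variable {Y ℬ} in
lemma reflection_apply (φ : Y → ℬ) (y : Y) : reflection Y ℬ φ y = φ (-y) := rfl

/-- The space of even functions on `Y`. -/
def evenFun : Submodule ℬ (Y → ℬ) :=
  LinearMap.eqLocus (reflection Y ℬ : (Y → ℬ) →ₗ[ℬ] (Y → ℬ)) LinearMap.id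

variable {Y ℬ} in
lemma mem_evenFun {φ : Y → ℬ} : φ ∈ evenFun Y ℬ ↔ reflection Y ℬ φ = φ := Iff.rfl

/-- The group of automorphisms of the space of functions commuting with the reflection. -/
abbrev reflectionCentralizer : Subgroup ((Y → ℬ) ≃ₗ[ℬ] (Y → ℬ)) :=
  Subgroup.centralizer {reflection Y ℬ}

variable {Y ℬ} in
lemma evenFun_map (M : reflectionCentralizer Y ℬ) :
    ∀ φ ∈ evenFun Y ℬ, (M : (Y → ℬ) ≃ₗ[ℬ] (Y → ℬ)).toLinearMap φ ∈ evenFun Y ℬ := by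
  intro φ hφ
  have h := Subgroup.mem_centralizer_iff.mp M.2 _ rfl
  have hcomm := LinearEquiv.congr_fun h φ
  rw [mem_evenFun] at hφ ⊢
  change reflection Y ℬ (M.1 φ) = M.1 (reflection Y ℬ φ) at hcomm
  rwa [hφ] at hcomm

/-- Restriction to even functions. -/
def evenRestrict : reflectionCentralizer Y ℬ →* Module.End ℬ (evenFun Y ℬ) where
  toFun M := (M : (Y → ℬ) ≃ₗ[ℬ] (Y → ℬ)).toLinearMap.restrict (evenFun_map M)
  map_one' := rfl
  map_mul' _ _ := rfl

/-- The functional `det(M | even functions)² / det(M)`. -/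
def reflectionDet : reflectionCentralizer Y ℬ →* ℬˣ :=
  (LinearMap.det.comp (evenRestrict Y ℬ)).toHomUnits ^ 2 *
    (LinearEquiv.det.comp (reflectionCentralizer Y ℬ).subtype)⁻¹

variable {Y} [Fintype Y]

/-- A half system for the reflection of `Y`. -/
lemma exists_half_system (hY : ∀ y : Y, -y = y → y = 0) :
    ∃ R : Finset Y, 2 * R.card = Fintype.card Y + 1 ∧
      (∀ y, y ∈ R ∨ -y ∈ R) ∧ ∀ y ∈ R, -y ∈ R → y = 0 := by
  classical
  let f := Fintype.equivFin Y
  let R : Finset Y := {y | f y ≤ f (-y)}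
  have hR : ∀ y, y ∈ R ↔ f y ≤ f (-y) := by simp [R]
  have h1 : ∀ y, y ∈ R ∨ -y ∈ R := by
    intro y
    rw [hR, hR, neg_neg]
    exact le_total _ _
  have h2 : ∀ y ∈ R, -y ∈ R → y = 0 := by
    intro y hy hy'
    rw [hR] at hy hy'
    rw [neg_neg] at hy'
    exact hY y (f.injective (le_antisymm hy' hy))
  refine ⟨R, ?_, h1, h2⟩
  have hneg : ∀ y, y ∈ R.image (fun y => -y) ↔ -y ∈ R := by
    intro y
    simp [neg_eq_iff_eq_neg]
  have hunion : R ∪ R.image (fun y => -y) = Finset.univ := by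
    ext y
    simpa only [Finset.mem_union, hneg, Finset.mem_univ, iff_true] using h1 y
  have hinter : R ∩ R.image (fun y => -y) = {0} := by
    ext y
    rw [Finset.mem_inter, hneg, Finset.mem_singleton]
    refine ⟨fun h => h2 y h.1 h.2, ?_⟩
    rintro rfl
    simp [hR]
  have hcard := Finset.card_union_add_card_inter R (R.image fun y => -y)
  rw [hunion, hinter, Finset.card_image_of_injective _ neg_injective, Finset.card_univ,
    Finset.card_singleton] at hcard
  omega

lemma exists_evenFun_equiv (hY : ∀ y : Y, -y = y → y = 0) :
    ∃ R : Finset Y, 2 * R.card = Fintype.card Y + 1 ∧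
      Nonempty (evenFun Y ℬ ≃ₗ[ℬ] (R → ℬ)) := by
  classical
  obtain ⟨R, hcard, hR, hR'⟩ := exists_half_system hY
  refine ⟨R, hcard, ⟨LinearEquiv.ofBijective
    ((LinearMap.funLeft ℬ ℬ (Subtype.val : R → Y)).comp (evenFun Y ℬ).subtype) ⟨?_, ?_⟩⟩⟩
  · rw [← LinearMap.ker_eq_bot, LinearMap.ker_eq_bot']
    rintro ⟨φ, hφ⟩ h
    ext y
    have h0 : ∀ y ∈ R, φ y = 0 := fun y hy => congr_fun h ⟨y, hy⟩
    rcases hR y with hy | hy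
    · exact h0 y hy
    · exact (congr_fun (mem_evenFun.mp hφ) y).symm.trans (h0 _ hy)
  · intro φ
    refine ⟨⟨fun y => if h : y ∈ R then φ ⟨y, h⟩ else if h : -y ∈ R then φ ⟨-y, h⟩ else 0, ?_⟩, ?_⟩
    · rw [mem_evenFun]
      funext y
      rw [reflection_apply]
      by_cases hy : y ∈ R <;> by_cases hy' : -y ∈ R
      · obtain rfl := hR' y hy hy'
        simp
      · simp [hy, hy']
      · simp [hy, hy']
      · simp [hy, hy']
    · funext y
      simp [LinearMap.funLeft_apply]

/-- The functional `reflectionDet` is homogeneous of degree one. -/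
lemma reflectionDet_smul (hY : ∀ y : Y, -y = y → y = 0) (a : ℬˣ) (M : reflectionCentralizer Y ℬ)
    (hM : (M : (Y → ℬ) ≃ₗ[ℬ] (Y → ℬ)) = DistribMulAction.toModuleAut ℬ (Y → ℬ) a) :
    reflectionDet Y ℬ M = a := by
  obtain ⟨R, hcard, ⟨Φ⟩⟩ := exists_evenFun_equiv ℬ hY
  nontriviality ℬ
  have hfree : Module.Free ℬ (evenFun Y ℬ) := Module.Free.of_equiv Φ.symm
  have hrank : Module.finrank ℬ (evenFun Y ℬ) = R.card := by
    rw [Φ.finrank_eq, Module.finrank_fintype_fun_eq_card, Fintype.card_coe]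
  have h1 : evenRestrict Y ℬ M = (a : ℬ) • LinearMap.id := by
    ext φ y
    change (M : (Y → ℬ) ≃ₗ[ℬ] (Y → ℬ)) φ y = _
    rw [hM]
    rfl
  have h2 : ((M : (Y → ℬ) ≃ₗ[ℬ] (Y → ℬ)) : (Y → ℬ) →ₗ[ℬ] (Y → ℬ)) = (a : ℬ) • LinearMap.id := by
    rw [hM]
    rfl
  have h3 : (LinearMap.det.comp (evenRestrict Y ℬ)).toHomUnits M = a ^ R.card := by
    ext
    rw [MonoidHom.coe_toHomUnits, MonoidHom.comp_apply, h1, LinearMap.det_smul, hrank]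
    simp
  have h4 : LinearEquiv.det.comp (reflectionCentralizer Y ℬ).subtype M = a ^ Fintype.card Y := by
    ext
    rw [MonoidHom.comp_apply, LinearEquiv.coe_det, Subgroup.subtype_apply, h2, LinearMap.det_smul]
    simp
  rw [reflectionDet, MonoidHom.mul_apply, MonoidHom.pow_apply, MonoidHom.inv_apply, h3, h4,
    ← pow_mul, mul_comm R.card, hcard, pow_succ]
  group

lemma trace_reflection (hY : ∀ y : Y, -y = y → y = 0) :
    LinearMap.trace ℬ (Y → ℬ) (reflection Y ℬ : (Y → ℬ) →ₗ[ℬ] (Y → ℬ)) = 1 := by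
  classical
  rw [LinearMap.trace_eq_matrix_trace ℬ (Pi.basisFun ℬ Y), Matrix.trace, Fintype.sum_eq_single 0]
  · simp [reflection_apply]
  · intro y hy
    simp only [Matrix.diag_apply, LinearMap.toMatrix_apply, Pi.basisFun_apply, Pi.basisFun_repr,
      LinearEquiv.coe_coe, reflection_apply]
    exact Pi.single_eq_of_ne (fun h => hy (hY y h)) _

end Reflection

/-- A central extension carrying a functional which restricts to the identity on the centre
splits. -/
theorem exists_splitting {G L A : Type*} [Group G] [Group L] [CommGroup A]
    (Γ : Subgroup (G × L)) (hsurj : ∀ g, ∃ M, (g, M) ∈ Γ) (σ : A →* L)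
    (hcomm : ∀ a M, σ a * M = M * σ a) (hσ : ∀ a, (1, σ a) ∈ Γ)
    (hker : ∀ M, (1, M) ∈ Γ → ∃ a, M = σ a)
    (D : Γ →* A) (hD : ∀ a, D ⟨(1, σ a), hσ a⟩ = a) :
    ∃ Ω : G →* L, ∀ g, (g, Ω g) ∈ Γ := by
  choose m hm using hsurj
  let n : ∀ x : Γ, L := fun x => σ (D x)⁻¹ * x.1.2
  have hn_mul : ∀ x y, n (x * y) = n x * n y := by
    intro x y
    simp only [n, map_mul, mul_inv_rev, Subgroup.coe_mul, Prod.snd_mul]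
    rw [hcomm (D y)⁻¹ (σ _), mul_assoc, mul_assoc, ← mul_assoc x.1.2, ← hcomm (D y)⁻¹, mul_assoc]
  have hn_one : ∀ x : Γ, x.1.1 = 1 → n x = 1 := by
    rintro ⟨⟨g, M⟩, hx⟩ rfl
    obtain ⟨a, rfl⟩ := hker M hx
    simp only [n, hD, map_inv, inv_mul_cancel]
  have hn : ∀ x y : Γ, x.1.1 = y.1.1 → n x = n y := by
    intro x y hxy
    have h := hn_one (x * y⁻¹) (by simp [hxy])
    have h' := hn_mul (x * y⁻¹) y
    rwa [inv_mul_cancel_right, h, one_mul] at h'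
  refine ⟨MonoidHom.mk' (fun g => n ⟨(g, m g), hm g⟩) fun g g' => ?_, fun g => ?_⟩
  · rw [← hn_mul]
    exact hn _ _ rfl
  · have := Γ.mul_mem (hσ (D ⟨(g, m g), hm g⟩)⁻¹) (hm g)
    rwa [Prod.mk_mul_mk, one_mul] at this

/-! ## The Schrödinger model -/

section Model

variable {β : W →ₗ[F] W →ₗ[F] F} {ℬ : Type*} [CommRing ℬ]

/-- `ρ` is the Schrödinger representation on functions on `Y`, where `π` is a projection of `W`
onto the complement `Y` of a Lagrangian. -/
def IsSchrodinger {Y : Submodule F W} (π : W →ₗ[F] Y) (e : AddChar F ℬ)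
    (ρ : Heis β →* Module.End ℬ (Y → ℬ)) : Prop :=
  ∀ (h : Heis β) (φ : Y → ℬ) (y : Y), ρ h φ y =
    e (h.t + 2⁻¹ * β y h.w - 2⁻¹ * β (y + h.w) (y + π h.w : Y)) * φ (y + π h.w)

variable {Y : Submodule F W} {π : W →ₗ[F] Y} {e : AddChar F ℬ}
  {ρ : Heis β →* Module.End ℬ (Y → ℬ)}

lemma IsSchrodinger.central (hρ : IsSchrodinger π e ρ) (halt : ∀ v : W, β v v = 0) (t : F) :
    ρ ⟨0, t⟩ = e t • (1 : Module.End ℬ (Y → ℬ)) := by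
  refine LinearMap.ext fun φ => funext fun y => ?_
  rw [hρ]
  simp [halt]

lemma IsSchrodinger.reflection_apply (hρ : IsSchrodinger π e ρ) (h : Heis β) (φ : Y → ℬ) :
    reflection Y ℬ (ρ h φ) = ρ ⟨-h.w, h.t⟩ (reflection Y ℬ φ) := by
  funext y
  rw [_root_.reflection_apply, hρ, hρ, _root_.reflection_apply]
  congr 2
  · simp only [map_neg, map_add, LinearMap.add_apply, LinearMap.neg_apply, Submodule.coe_add,
      Submodule.coe_neg]
    ring
  · simp [add_comm]

/-- Schur's lemma for the Schrödinger representation. -/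
theorem IsSchrodinger.schur [Fintype F] [Finite W] (hρ : IsSchrodinger π e ρ)
    (halt : ∀ v : W, β v v = 0)
    (hsum : ∀ b : F, b ≠ 0 → ∑ t, e (b * t) = 0) (h2 : (2 : F) ≠ 0)
    (hq : IsUnit (Fintype.card F : ℬ)) {X : Submodule F W} (hπX : ∀ x ∈ X, π x = 0)
    (hπY : ∀ y : Y, π y = y)
    (hXY : ∀ y : Y, (∀ x ∈ X, β y x = 0) → y = 0)
    (T : Module.End ℬ (Y → ℬ)) (hT : ∀ h φ, T (ρ h φ) = ρ h (T φ)) :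
    ∃ a : ℬ, ∀ φ, T φ = a • φ := by
  classical
  have := Fintype.ofFinite Y
  have hx : ∀ x ∈ X, ∀ (φ : Y → ℬ) (y : Y), ρ ⟨x, 0⟩ φ y = e (β y x) * φ y := by
    intro x hx φ y
    rw [hρ, hπX x hx, add_zero]
    congr 2
    simp only [map_add, LinearMap.add_apply, halt, alternating_neg halt x y]
    field_simp
    ring
  have hy : ∀ (z : Y) (φ : Y → ℬ) (y : Y), ρ ⟨z, 0⟩ φ y = e (2⁻¹ * β y z) * φ (y + z) := by
    intro z φ y
    rw [hρ, hπY z]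
    congr 2
    simp [halt, alternating_neg halt (z : W) y]
  have hoff : ∀ z y : Y, y ≠ z → T (Pi.single z 1) y = 0 := by
    intro z y hyz
    obtain ⟨x, hxX, hβ⟩ : ∃ x ∈ X, β (y - z : Y) x ≠ 0 := by
      by_contra! h
      exact hyz (sub_eq_zero.mp (hXY _ h))
    have hinv : ∀ t : F, T (Pi.single z 1) y = e (β (y - z : Y) x * t) * T (Pi.single z 1) y := by
      intro t
      have htx : t • x ∈ X := X.smul_mem t hxX
      have hz : ρ ⟨t • x, 0⟩ (Pi.single z 1) = e (β z (t • x)) • (Pi.single z 1 : Y → ℬ) := by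
        funext y'
        rw [hx _ htx]
        by_cases h : y' = z
        · subst h
          simp
        · simp [h]
      have hcomm := congr_fun (hT ⟨t • x, 0⟩ (Pi.single z 1)) y
      rw [hz, map_smul, hx _ htx, Pi.smul_apply, smul_eq_mul] at hcomm
      have hsplit : e (β (y - z : Y) x * t) = e (-β z (t • x)) * e (β y (t • x)) := by
        rw [← AddChar.map_add_eq_mul]
        congr 1
        simp
        ring
      rw [hsplit, mul_assoc, ← hcomm, ← mul_assoc, ← AddChar.map_add_eq_mul]
      simp
    have hzero : (Fintype.card F : ℬ) * T (Pi.single z 1) y = 0 := by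
      have hs : ∑ _t : F, T (Pi.single z 1) y =
          ∑ t : F, e (β (y - z : Y) x * t) * T (Pi.single z 1) y :=
        Finset.sum_congr rfl fun t _ => hinv t
      rwa [← Finset.sum_mul, hsum _ hβ, zero_mul, Finset.sum_const, Finset.card_univ,
        nsmul_eq_mul] at hs
    exact (hq.mul_right_eq_zero).mp hzero
  have hdiag : ∀ (φ : Y → ℬ) (y : Y), T φ y = T (Pi.single y 1) y * φ y := by
    intro φ y
    conv_lhs => rw [pi_eq_sum_univ' φ]
    rw [map_sum, Finset.sum_apply, Fintype.sum_eq_single y]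
    · rw [map_smul, Pi.smul_apply, smul_eq_mul, mul_comm]
    · intro z hz
      rw [map_smul, Pi.smul_apply, hoff z y hz.symm, smul_zero]
  refine ⟨T (Pi.single 0 1) 0, fun φ => funext fun y => ?_⟩
  have h := congr_fun (hT ⟨y, 0⟩ 1) 0
  rw [hdiag, hy, hy, hdiag 1] at h
  rw [hdiag, Pi.smul_apply, smul_eq_mul]
  simp at h
  rw [h]

/-- The metaplectic extension attached to the Schrödinger model splits. -/
theorem IsSchrodinger.exists_weil [Fintype F] [FiniteDimensional F W] [Finite W]
    (hρ : IsSchrodinger π e ρ) (halt : ∀ v : W, β v v = 0)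
    (hnd : ∀ v : W, (∀ u : W, β v u = 0) → v = 0)
    (hsum : ∀ b : F, b ≠ 0 → ∑ t, e (b * t) = 0) (h2 : (2 : F) ≠ 0)
    (hq : IsUnit (Fintype.card F : ℬ)) {X : Submodule F W} (hπX : ∀ x ∈ X, π x = 0)
    (hπY : ∀ y : Y, π y = y)
    (hXY : ∀ y : Y, (∀ x ∈ X, β y x = 0) → y = 0) :
    ∃ Ω : SpGrp β →* ((Y → ℬ) ≃ₗ[ℬ] (Y → ℬ)), ∀ g h φ,
      Ω g (ρ h φ) = ρ (gHeis β (g : W ≃ₗ[F] W) h) (Ω g φ) := by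
  have := Fintype.ofFinite Y
  have hY : ∀ y : Y, -y = y → y = 0 := by
    intro y hy
    have h : (2 : F) • y = 0 := by rw [two_smul, ← sub_neg_eq_add, hy, sub_self]
    exact (smul_eq_zero.mp h).resolve_left h2
  let σ := DistribMulAction.toModuleAut (S := ℬˣ) ℬ (Y → ℬ)
  let Γ : Subgroup (SpGrp β × ((Y → ℬ) ≃ₗ[ℬ] (Y → ℬ))) :=
    { carrier := {x | ∀ h φ, x.2 (ρ h φ) = ρ (gHeis β (x.1 : W ≃ₗ[F] W) h) (x.2 φ)}
      one_mem' := fun _ _ => rfl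
      mul_mem' := by
        intro x y hx hy h φ
        change x.2 (y.2 _) = ρ (gHeis β x.1 (gHeis β y.1 h)) (x.2 (y.2 φ))
        rw [hy, hx]
      inv_mem' := by
        intro x hx h φ
        change x.2.symm _ = ρ _ (x.2.symm φ)
        rw [LinearEquiv.symm_apply_eq, hx, LinearEquiv.apply_symm_apply]
        congr 2
        ext
        · exact ((x.1 : W ≃ₗ[F] W).apply_symm_apply h.w).symm
        · rfl }
  have hscalar : ∀ M : (Y → ℬ) ≃ₗ[ℬ] (Y → ℬ), (∀ h φ, M (ρ h φ) = ρ h (M φ)) →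
      ∃ a : ℬˣ, M = σ a := by
    intro M hM
    obtain ⟨a, ha⟩ := hρ.schur halt hsum h2 hq hπX hπY hXY M.toLinearMap hM
    obtain ⟨b, hb⟩ := hρ.schur halt hsum h2 hq hπX hπY hXY M.symm.toLinearMap (by
      intro h φ
      simp only [LinearEquiv.coe_coe]
      rw [LinearEquiv.symm_apply_eq, hM, LinearEquiv.apply_symm_apply])
    simp only [LinearEquiv.coe_coe] at ha hb
    have hab : a * b = 1 := by
      have h := congr_fun (M.apply_symm_apply 1) 0
      rw [ha, hb] at h
      simpa using h
    exact ⟨⟨a, b, hab, by rw [mul_comm, hab]⟩, LinearEquiv.ext ha⟩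
  have hσcomm : ∀ a M, σ a * M = M * σ a := by
    intro a M
    refine LinearEquiv.ext fun φ => ?_
    exact (map_smul M (a : ℬ) φ).symm
  have hcent : ∀ x : Γ, x.1.2 ∈ reflectionCentralizer Y ℬ := by
    rintro ⟨⟨g, M⟩, hM⟩
    replace hM : ∀ h φ, M (ρ h φ) = ρ (gHeis β (g : W ≃ₗ[F] W) h) (M φ) := hM
    set E := reflection Y ℬ with hE
    have hEρ : ∀ h φ, E (ρ h φ) = ρ ⟨-h.w, h.t⟩ (E φ) := hρ.reflection_apply
    have hEE : E * E = 1 := by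
      refine LinearEquiv.ext fun φ => funext fun y => ?_
      change φ (- -y) = φ y
      rw [neg_neg]
    obtain ⟨a, ha⟩ := hscalar (M * E * M⁻¹ * E) (by
      intro h φ
      change M (E (M.symm (E (ρ h φ)))) = ρ h (M (E (M.symm (E φ))))
      have hsymm : ∀ h φ, M.symm (ρ (gHeis β (g : W ≃ₗ[F] W) h) φ) = ρ h (M.symm φ) := by
        intro h φ
        rw [LinearEquiv.symm_apply_eq, hM, LinearEquiv.apply_symm_apply]
      have hneg : (⟨-h.w, h.t⟩ : Heis β) = gHeis β (g : W ≃ₗ[F] W)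
          ⟨-(g : W ≃ₗ[F] W).symm h.w, h.t⟩ := by
        ext <;> simp [gHeis]
      rw [hEρ, hneg, hsymm, hEρ, hM]
      congr 2
      ext <;> simp [gHeis])
    have hconj : M * E * M⁻¹ = σ a * E := by
      rw [← ha, mul_assoc _ E E, hEE, mul_one]
    have htr : (1 : ℬ) = a := by
      have h1 : LinearMap.trace ℬ (Y → ℬ) (M * E * M⁻¹ : (Y → ℬ) ≃ₗ[ℬ] (Y → ℬ)).toLinearMap = 1 :=
        (LinearMap.trace_conj' E.toLinearMap M).trans (trace_reflection ℬ hY)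
      have h3 : (σ a * E : (Y → ℬ) ≃ₗ[ℬ] (Y → ℬ)).toLinearMap = (a : ℬ) • E.toLinearMap := rfl
      rw [hconj, h3, map_smul, trace_reflection ℬ hY, smul_eq_mul, mul_one] at h1
      exact h1.symm
    have ha1 : a = 1 := Units.ext htr.symm
    rw [Subgroup.mem_centralizer_singleton_iff]
    rw [ha1, map_one, one_mul, mul_inv_eq_iff_eq_mul] at hconj
    exact hconj
  have hσΓ : ∀ a, ((1 : SpGrp β), σ a) ∈ Γ := fun a h φ => (map_smul (ρ h) (a : ℬ) φ).symm
  obtain ⟨Ω, hΩ⟩ := exists_splitting Γ (fun g => mem_of_spTransvection_mem halt hnd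
      (implementable ρ) (spTransvection_mem_implementable halt (hρ.central halt) hsum h2 hq) g g.2)
    σ hσcomm hσΓ (fun M hM => hscalar M hM)
    ((reflectionDet Y ℬ).comp
      (((MonoidHom.snd _ _).comp Γ.subtype).codRestrict (reflectionCentralizer Y ℬ) hcent))
    (fun a => reflectionDet_smul ℬ hY a _ rfl)
  exact ⟨Ω, hΩ⟩

end Model

/-! ## The Schrödinger model of the induced representation -/

section Induced

variable {β : W →ₗ[F] W →ₗ[F] F}

/-- A maximal isotropic subspace contains its orthogonal. -/
lemma mem_of_orthogonal (halt : ∀ v : W, β v v = 0) {X : Submodule F W}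
    (hiso : ∀ x ∈ X, ∀ y ∈ X, β x y = 0)
    (hmax : ∀ Y : Submodule F W, X ≤ Y → (∀ x ∈ Y, ∀ y ∈ Y, β x y = 0) → Y = X)
    (v : W) (hv : ∀ x ∈ X, β v x = 0) : v ∈ X := by
  have hv' : ∀ x ∈ X, β x v = 0 := fun x hx => by rw [alternating_neg halt, hv x hx, neg_zero]
  have h := hmax (X ⊔ F ∙ v) le_sup_left (by
    intro x hxs y hys
    obtain ⟨x, hx, _, hx', rfl⟩ := Submodule.mem_sup.mp hxs
    obtain ⟨a, rfl⟩ := Submodule.mem_span_singleton.mp hx'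
    obtain ⟨y, hy, _, hy', rfl⟩ := Submodule.mem_sup.mp hys
    obtain ⟨b, rfl⟩ := Submodule.mem_span_singleton.mp hy'
    simp [hiso x hx y hy, hv y hy, hv' x hx, halt])
  rw [← h]
  exact Submodule.mem_sup_right (Submodule.mem_span_singleton_self v)

/-- Every character of a subspace is given by pairing with a vector of `W`. -/
lemma exists_eq_addChar_pairing {R : Type*} [CommRing R] [IsDomain R] [Fintype F] [Fintype W]
    (hnd : ∀ v : W, (∀ u : W, β v u = 0) → v = 0) {e : AddChar F R} (he1 : e ≠ 1)
    (hW : (Fintype.card W : R) ≠ 0)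
    (halt : ∀ v : W, β v v = 0) (X : Submodule F W) (χ : AddChar X R) :
    ∃ w : W, ∀ x : X, χ x = e (β w x) := by
  classical
  have := Fintype.ofFinite X
  let pair (x : W) : AddChar W R := e.compAddMonoidHom (β.flip x).toAddMonoidHom
  let twist (w : W) : AddChar X R := χ * e.compAddMonoidHom (-((β w).comp X.subtype)).toAddMonoidHom
  have hpair : ∀ x w, pair x w = e (β w x) := fun _ _ => rfl
  have htwist : ∀ w x, twist w x = χ x * e (-β w x) := fun _ _ => rfl
  by_contra! hcon
  have hzero : ∀ w, ∑ x, twist w x = 0 := by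
    intro w
    rw [AddChar.sum_eq_ite, if_neg]
    intro h0
    obtain ⟨x, hx⟩ := hcon w
    apply hx
    have h : twist w x = 1 := by rw [h0, AddChar.zero_apply]
    rw [htwist] at h
    calc χ x = χ x * (e (-β w x) * e (β w x)) := by
          rw [← AddChar.map_add_eq_mul, neg_add_cancel, AddChar.map_zero_eq_one, mul_one]
      _ = e (β w x) := by rw [← mul_assoc, h, one_mul]
  have htotal : ∑ w, ∑ x, twist w x = (Fintype.card W : R) := by
    rw [Finset.sum_comm, Fintype.sum_eq_single 0]
    · simp [htwist]
    · intro x hx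
      simp_rw [htwist, ← Finset.mul_sum]
      have hp : ∑ w, e (-β w x) = ∑ w, pair (-(x : W)) w := by simp [hpair]
      rw [hp, AddChar.sum_eq_ite, if_neg, mul_zero]
      intro h0
      apply hx
      refine Subtype.ext (hnd x fun u => ?_)
      by_contra hne
      obtain ⟨s, hs⟩ := AddChar.ne_one_iff.mp he1
      apply hs
      have h : pair (-(x : W)) ((s * (β x u)⁻¹) • u) = 1 := by rw [h0, AddChar.zero_apply]
      rwa [hpair, map_neg, alternating_neg halt, neg_neg, map_smul, smul_eq_mul,
        inv_mul_cancel_right₀ hne] at h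
  rw [Finset.sum_congr rfl fun w _ => hzero w, Finset.sum_const_zero] at htotal
  exact hW htotal.symm

variable {ℬ : Type*} [CommRing ℬ]

/-- The induced representation as a homomorphism. -/
def indRep (β : W →ₗ[F] W →ₗ[F] F) (ℬ : Type*) [CommRing ℬ] (A : AddSubgroup W)
    (χ : Heis β → ℬˣ) : Heis β →* Module.End ℬ (IndV β ℬ A χ) where
  toFun := hActV β ℬ A χ
  map_one' := by
    ext f h
    change f.1 (h * 1) = f.1 h
    rw [mul_one]
  map_mul' h₁ h₂ := by
    ext f h
    change f.1 (h * (h₁ * h₂)) = f.1 (h * h₁ * h₂)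
    rw [mul_assoc]

/-- Evaluation of an element of the induced representation on a translate of `Y`. -/
def evalTranslate {A : AddSubgroup W} {χ : Heis β → ℬˣ} (Y : Submodule F W) (k : W) :
    IndV β ℬ A χ →ₗ[ℬ] (Y → ℬ) where
  toFun f y := f.1 (⟨k, 0⟩ * ⟨y, 0⟩)
  map_add' _ _ := rfl
  map_smul' _ _ := rfl

variable {X Y : Submodule F W} {π : W →ₗ[F] Y} {e : AddChar F ℬ} {χ : Heis β → ℬˣ} {k : W}

lemma indV_apply (h2 : (2 : F) ≠ 0) (halt : ∀ v : W, β v v = 0) (hπ : ∀ v, π v = 0 ↔ v ∈ X)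
    (hπY : ∀ y : Y, π y = y)
    (hχ : ∀ x ∈ X, ∀ t, ((χ ⟨x, t + β k x⟩ : ℬˣ) : ℬ) = e t)
    (f : IndV β ℬ X.toAddSubgroup χ) (h : Heis β) :
    f.1 (⟨k, 0⟩ * h) =
      e (h.t - 2⁻¹ * β h.w (π h.w)) * evalTranslate Y k f (π h.w) := by
  have hx : h.w - π h.w ∈ X := by rw [← hπ, map_sub, hπY, sub_self]
  have hf := f.2 ⟨h.w - π h.w, h.t - 2⁻¹ * β h.w (π h.w) + β k (h.w - π h.w)⟩ hx
    (⟨k, 0⟩ * ⟨π h.w, 0⟩)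
  rw [hχ _ hx] at hf
  refine Eq.trans (congr_arg f.1 ?_) hf
  refine Heis.ext ?_ ?_
  · simp only [Heis.mul_w]
    abel
  · simp only [Heis.mul_t, Heis.mul_w, map_add, map_sub, LinearMap.sub_apply, halt,
      alternating_neg halt (π h.w : W) k, alternating_neg halt h.w k]
    field_simp
    ring

/-- The induced representation is isomorphic to a Schrödinger model. -/
theorem exists_schrodinger (h2 : (2 : F) ≠ 0) (halt : ∀ v : W, β v v = 0)
    (hiso : ∀ x ∈ X, ∀ y ∈ X, β x y = 0) (hπ : ∀ v, π v = 0 ↔ v ∈ X)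
    (hπY : ∀ y : Y, π y = y) (k : W)
    (hχ : ∀ x ∈ X, ∀ t, ((χ ⟨x, t + β k x⟩ : ℬˣ) : ℬ) = e t) :
    ∃ (J : IndV β ℬ X.toAddSubgroup χ ≃ₗ[ℬ] (Y → ℬ)) (ρ : Heis β →* Module.End ℬ (Y → ℬ)),
      IsSchrodinger π e ρ ∧
        ∀ h f, J (hActV β ℬ X.toAddSubgroup χ h f) = ρ h (J f) := by
  have happ := indV_apply h2 halt hπ hπY hχ
  have hcancel : ∀ h : Heis β, (⟨k, 0⟩ : Heis β) * (⟨-k, 0⟩ * h) = h := by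
    intro h
    ext
    · simp
    · simp [halt]
  have hbij : Function.Bijective (evalTranslate (A := X.toAddSubgroup) (χ := χ) Y k) := by
    constructor
    · rw [← LinearMap.ker_eq_bot, LinearMap.ker_eq_bot']
      intro f hf
      ext h
      rw [← hcancel h, happ, hf]
      simp
    · intro φ
      let f : Heis β → ℬ := fun h =>
        e (h.t - 2⁻¹ * β k h.w - 2⁻¹ * β (h.w - k) (π (h.w - k))) * φ (π (h.w - k))
      refine ⟨⟨f, ?_⟩, ?_⟩
      · intro a ha h
        have haX : a.w ∈ X := ha
        have hχa : ((χ a : ℬˣ) : ℬ) = e (a.t - β k a.w) := by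
          rw [← hχ a.w haX, sub_add_cancel]
        have hx : h.w - k - π (h.w - k) ∈ X := by rw [← hπ, map_sub, hπY, sub_self]
        have hperp := hiso _ haX _ hx
        have hw : π ((a * h).w - k) = π (h.w - k) := by
          rw [Heis.mul_w, add_sub_assoc, map_add, (hπ _).mpr haX, zero_add]
        simp only [f]
        rw [hw, hχa, ← mul_assoc, ← AddChar.map_add_eq_mul]
        congr 2
        simp only [map_sub] at hperp
        simp only [Heis.mul_t, Heis.mul_w, map_add, map_sub, LinearMap.add_apply,
          LinearMap.sub_apply]
        rw [alternating_neg halt a.w k] at hperp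
        field_simp
        linear_combination hperp
      · funext y
        change f (⟨k, 0⟩ * ⟨y, 0⟩) = φ y
        simp only [f, Heis.mul_w, Heis.mul_t, add_sub_cancel_left, hπY]
        simp [halt]
  let J := LinearEquiv.ofBijective _ hbij
  refine ⟨J, (J.conjRingEquiv : _ →* _).comp (indRep β ℬ X.toAddSubgroup χ), ?_, ?_⟩
  · intro h φ y
    obtain ⟨f, rfl⟩ := J.surjective φ
    change J (hActV β ℬ X.toAddSubgroup χ h (J.symm (J f))) y = _
    rw [J.symm_apply_apply]
    change f.1 (⟨k, 0⟩ * ⟨y, 0⟩ * h) = _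
    rw [mul_assoc, happ]
    have hπw : π ((⟨y, 0⟩ : Heis β) * h).w = y + π h.w := by rw [Heis.mul_w, map_add, hπY]
    rw [hπw]
    congr 2
    simp
  · intro h f
    change _ = J (hActV β ℬ X.toAddSubgroup χ h (J.symm (J f)))
    rw [J.symm_apply_apply]

end Induced

/-! ## The ring `𝒜` -/

lemma exists_injective_AA (p : ℕ+) :
    ∃ f : AA p →+* CyclotomicField p ℚ, Function.Injective f := by
  with_unfolding_all exact ⟨(Aint (p : ℕ) p).val.toRingHom, Subtype.val_injective⟩

lemma isDomain_AA (p : ℕ+) : IsDomain (AA p) := by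
  obtain ⟨f, hf⟩ := exists_injective_AA p
  exact hf.isDomain f

lemma isUnit_natCast_AA (p : ℕ+) : IsUnit ((p : ℕ) : AA p) := by
  obtain ⟨f⟩ : Nonempty (Localization.Away ((p : ℕ) : ℤ) →+* AA p) := by
    with_unfolding_all exact ⟨algebraMap (Localization.Away ((p : ℕ) : ℤ)) (Aint (p : ℕ) p)⟩
  have h := (IsLocalization.Away.algebraMap_isUnit (S := Localization.Away ((p : ℕ) : ℤ))
    ((p : ℕ) : ℤ)).map f
  simpa using h

/-- Over a finite field the metaplectic central extension splits: for a
Lagrangian `X` of `W` (which is a self-dual subgroup), there is a group homomorphism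
`ω : Sp(W) → GL_ℬ(V_X^ℬ)` with `ω(g) ρ(h) ω(g)⁻¹ = ρ(g·h)`, i.e. the 2-cocycle of the
Weil representation is trivial and `g ↦ (g, ω(g))` splits `S̃p_X^ℬ(W) → Sp(W)`. -/
theorem statement_9
    (p : ℕ+) [Fact (Nat.Prime (p : ℕ))] (hp2 : (p : ℕ) ≠ 2)
    {F : Type*} [Field F] [Fintype F] [CharP F (p : ℕ)]
    {W : Type*} [AddCommGroup W] [Module F W] [FiniteDimensional F W]
    (β : W →ₗ[F] W →ₗ[F] F)
    (halt : ∀ v : W, β v v = 0)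
    (hnd : ∀ v : W, (∀ u : W, β v u = 0) → v = 0)
    (ℬ : Type*) [CommRing ℬ] [Algebra (AA p) ℬ]
    (ψ : F → (AA p)ˣ) (hψ : ∀ x y : F, ψ (x + y) = ψ x * ψ y)
    (hψnt : ∃ x : F, ψ x ≠ 1)
    (X : Submodule F W)
    (hiso : ∀ x ∈ X, ∀ y ∈ X, β x y = 0)
    (hmax : ∀ Y : Submodule F W, X ≤ Y → (∀ x ∈ Y, ∀ y ∈ Y, β x y = 0) → Y = X)
    (ψX : Heis β → (AA p)ˣ)
    (hψX : ∀ a b : Heis β, a.w ∈ X.toAddSubgroup → b.w ∈ X.toAddSubgroup →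
      ψX (a * b) = ψX a * ψX b)
    (hψXext : ∀ t : F, ψX ⟨0, t⟩ = ψ t) :
    -- `X` is self dual
    (∀ v : W, (∀ x ∈ X, ψ (β v x) = 1) ↔ v ∈ X) ∧
    -- and the projection `S̃p_X^ℬ(W) → Sp(W)` admits a group-theoretic splitting
    ∃ Ω : ↥(SpGrp β) →*
        (↥(IndV β ℬ X.toAddSubgroup (chB p ℬ ψX)) ≃ₗ[ℬ]
          ↥(IndV β ℬ X.toAddSubgroup (chB p ℬ ψX))),
      ∀ (g : ↥(SpGrp β)) (h₀ : Heis β)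
        (f : ↥(IndV β ℬ X.toAddSubgroup (chB p ℬ ψX))),
        Ω g (hActV β ℬ X.toAddSubgroup (chB p ℬ ψX) h₀ f) =
          hActV β ℬ X.toAddSubgroup (chB p ℬ ψX) (gHeis β (g : W ≃ₗ[F] W) h₀)
            (Ω g f) := by
  have h2 : (2 : F) ≠ 0 := by
    intro h
    have hdvd : (p : ℕ) ∣ 2 := (CharP.cast_eq_zero_iff F (p : ℕ) 2).mp (by exact_mod_cast h)
    exact hp2 ((Nat.prime_dvd_prime_iff_eq Fact.out Nat.prime_two).mp hdvd)
  have hψ0 : ψ 0 = 1 := by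
    have h := hψ 0 0
    rwa [add_zero, left_eq_mul] at h
  have hdual : ∀ v : W, (∀ x ∈ X, ψ (β v x) = 1) → v ∈ X := by
    intro v hv
    refine mem_of_orthogonal halt hiso hmax v fun x hx => ?_
    by_contra hne
    obtain ⟨s, hs⟩ := hψnt
    apply hs
    have h := hv ((s * (β v x)⁻¹) • x) (X.smul_mem _ hx)
    rwa [map_smul, smul_eq_mul, inv_mul_cancel_right₀ hne] at h
  refine ⟨fun v => ⟨hdual v, fun hv x hx => by rw [hiso v hv x hx, hψ0]⟩, ?_⟩
  have hdom := isDomain_AA p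
  have hpu := isUnit_natCast_AA p
  have hWfin : Finite W := Module.finite_of_finite F
  have := Fintype.ofFinite W
  have hcardF : IsUnit (Fintype.card F : AA p) := by
    obtain ⟨n, -, hn⟩ := FiniteField.card F (p : ℕ)
    rw [hn, Nat.cast_pow]
    exact hpu.pow _
  have hcardW : (Fintype.card W : AA p) ≠ 0 := by
    rw [Module.card_eq_pow_finrank (K := F) (V := W), Nat.cast_pow]
    exact (hcardF.pow _).ne_zero
  let e : AddChar F (AA p) :=
    { toFun := fun t => (ψ t : AA p)
      map_zero_eq_one' := by rw [hψ0, Units.val_one]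
      map_add_eq_mul' := fun s t => by rw [hψ, Units.val_mul] }
  have he1 : e ≠ 1 := by
    rw [AddChar.ne_one_iff]
    obtain ⟨x, hx⟩ := hψnt
    exact ⟨x, fun h => hx (Units.ext h)⟩
  have hesum : ∀ b : F, b ≠ 0 → ∑ t, e (b * t) = 0 := by
    classical
    intro b hb
    have h := AddChar.sum_mulShift b (AddChar.IsPrimitive.of_ne_one he1)
    simpa only [mul_comm b, if_neg hb, Nat.cast_zero] using h
  let χ : AddChar X (AA p) :=
    { toFun := fun x => (ψX ⟨x, 0⟩ : AA p)
      map_zero_eq_one' := by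
        rw [Submodule.coe_zero, hψXext, hψ0, Units.val_one]
      map_add_eq_mul' := fun x y => by
        rw [← Units.val_mul, ← hψX _ _ x.2 y.2]
        congr 2
        ext <;> simp [hiso x x.2 y y.2] }
  obtain ⟨w, hw⟩ := exists_eq_addChar_pairing hnd he1 hcardW halt X χ
  obtain ⟨Y, hXY⟩ := X.exists_isCompl
  let π : W →ₗ[F] Y := Y.projectionOnto X hXY.symm
  let eB : AddChar F ℬ := (algebraMap (AA p) ℬ).toMonoidHom.compAddChar e
  have hχ : ∀ x ∈ X, ∀ t, ((chB p ℬ ψX ⟨x, t + β (-w) x⟩ : ℬˣ) : ℬ) = eB t := by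
    intro x hx t
    change algebraMap (AA p) ℬ (ψX _ : AA p) = algebraMap (AA p) ℬ (e t)
    congr 1
    have hsplit : (⟨x, t + β (-w) x⟩ : Heis β) = ⟨0, t + β (-w) x⟩ * ⟨x, 0⟩ := by ext <;> simp
    rw [hsplit, hψX _ _ X.zero_mem hx, hψXext, Units.val_mul]
    have hwx : (ψX ⟨x, 0⟩ : AA p) = e (β w x) := hw ⟨x, hx⟩
    change e (t + β (-w) x) * _ = _
    rw [hwx, ← AddChar.map_add_eq_mul]
    simp
  have hπ : ∀ v, π v = 0 ↔ v ∈ X := fun v => Submodule.projectionOnto_apply_eq_zero_iff _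
  have hπY : ∀ y : Y, π y = y := fun y => Submodule.projectionOnto_apply_left _ y
  obtain ⟨J, ρ, hρ, hJ⟩ := exists_schrodinger h2 halt hiso hπ hπY (-w) hχ
  obtain ⟨Ω, hΩ⟩ := hρ.exists_weil halt hnd
    (fun b hb => by
      have h := congr_arg (algebraMap (AA p) ℬ) (hesum b hb)
      rwa [map_sum, map_zero] at h)
    h2 (by simpa using hcardF.map (algebraMap (AA p) ℬ)) (fun x hx => (hπ x).mpr hx) hπY
    (fun y hy => by
      have hyX := mem_of_orthogonal halt hiso hmax (y : W) hy
      rw [← hπY y, (hπ y).mpr hyX])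
  refine ⟨MonoidHom.mk' (fun g => (J.trans (Ω g)).trans J.symm) fun g g' => ?_, fun g h f => ?_⟩
  · refine LinearEquiv.ext fun f => ?_
    change J.symm (Ω (g * g') (J f)) = J.symm (Ω g (J (J.symm (Ω g' (J f)))))
    rw [J.apply_symm_apply, map_mul]
    rfl
  change J.symm (Ω g (J _)) = hActV _ _ _ _ _ (J.symm (Ω g (J f)))
  rw [hJ, hΩ, LinearEquiv.symm_apply_eq, hJ, LinearEquiv.apply_symm_apply]
end
end

section
/- Let G be a group, R a commutative ring, and V a module over the group algebra R[G]. Suppose that the map I ↦ I·V is a bijection from the set of ideals of R onto the set of R[G]-submodules of V. Then for every prime ideal P of R, the module V ⊗_R k(P), where k(P) is the fraction field of R/P, is a nonzero simple k(P)[G]-module. -/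
noncomputable section

open scoped TensorProduct

set_option maxHeartbeats 1000000
set_option synthInstance.maxHeartbeats 1000000

/-- The `R`-linear action of an element `g ∈ G` on an `R[G]`-module `V`
(an `R`-module with a `G`-action by `R`-linear automorphisms, i.e. a module over
the group algebra `MonoidAlgebra R G`). -/
def gAction (R G V : Type*) [CommRing R] [Group G] [AddCommGroup V] [Module R V]
    [Module (MonoidAlgebra R G) V] [IsScalarTower R (MonoidAlgebra R G) V] (g : G) :
    V →ₗ[R] V where
  toFun v := MonoidAlgebra.of R G g • v
  map_add' u v := smul_add _ u v
  map_smul' r v := by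
    simp only [RingHom.id_apply]
    rw [← algebraMap_smul (MonoidAlgebra R G) r v, ← mul_smul, ← Algebra.commutes,
      mul_smul, algebraMap_smul]

/-- The base change to the residue field `k(P) = Frac(R/P)` of the `G`-action on `V`,
as a representation of `G` on `V ⊗_R k(P)`. -/
def residueRep (R G V : Type*) [CommRing R] [Group G] [AddCommGroup V] [Module R V]
    [Module (MonoidAlgebra R G) V] [IsScalarTower R (MonoidAlgebra R G) V]
    (P : Ideal R) [P.IsPrime] :
    Representation (FractionRing (R ⧸ P)) G (FractionRing (R ⧸ P) ⊗[R] V) where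
  toFun g := LinearMap.baseChange (FractionRing (R ⧸ P)) (gAction R G V g)
  map_one' := by
    have h1 : gAction R G V (1 : G) = LinearMap.id := by
      refine LinearMap.ext fun v => ?_
      show MonoidAlgebra.of R G 1 • v = v
      rw [map_one, one_smul]
    show LinearMap.baseChange (FractionRing (R ⧸ P)) (gAction R G V 1) = 1
    rw [h1, LinearMap.baseChange_id]
    rfl
  map_mul' g g' := by
    have h1 : gAction R G V (g * g') = gAction R G V g ∘ₗ gAction R G V g' := by
      refine LinearMap.ext fun v => ?_
      show MonoidAlgebra.of R G (g * g') • v =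
        MonoidAlgebra.of R G g • (MonoidAlgebra.of R G g' • v)
      rw [map_mul, mul_smul]
    show LinearMap.baseChange (FractionRing (R ⧸ P)) (gAction R G V (g * g')) =
      LinearMap.baseChange (FractionRing (R ⧸ P)) (gAction R G V g) *
        LinearMap.baseChange (FractionRing (R ⧸ P)) (gAction R G V g')
    rw [h1, LinearMap.baseChange_comp]
    rfl

instance residueRep.instAddCommGroup (R G V : Type*) [CommRing R] [Group G]
    [AddCommGroup V] [Module R V] [Module (MonoidAlgebra R G) V]
    [IsScalarTower R (MonoidAlgebra R G) V] (P : Ideal R) [P.IsPrime] :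
    AddCommGroup ((residueRep R G V P).asModule) :=
  inferInstanceAs (AddCommGroup (FractionRing (R ⧸ P) ⊗[R] V))

theorem algebraMap_fractionRing_quotient_eq_zero_iff {R : Type*} [CommRing R] (P : Ideal R)
    (r : R) :
    algebraMap R (FractionRing (R ⧸ P)) r = 0 ↔ r ∈ P := by
  rw [IsScalarTower.algebraMap_apply R (R ⧸ P) (FractionRing (R ⧸ P)),
    FaithfulSMul.algebraMap_eq_zero_iff]
  exact Ideal.Quotient.eq_zero_iff_mem

section ResidueField

variable {R V : Type*} [CommRing R] [AddCommGroup V] [Module R V] (P : Ideal R)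

theorem one_tmul_eq_zero_of_mem_smul_top {v : V} (hv : v ∈ P • (⊤ : Submodule R V)) :
    (1 : FractionRing (R ⧸ P)) ⊗ₜ[R] v = 0 := by
  induction hv using Submodule.smul_induction_on' with
  | smul r hr x _ =>
    rw [TensorProduct.tmul_smul, TensorProduct.smul_tmul', Algebra.smul_def,
      (algebraMap_fractionRing_quotient_eq_zero_iff P r).mpr hr, zero_mul,
      TensorProduct.zero_tmul]
  | add x _ y _ hx hy => rw [TensorProduct.tmul_add, hx, hy, add_zero]

variable [P.IsPrime]

/-- Every element of `k(P) ⊗ V` becomes a pure tensor `1 ⊗ v` after multiplication by some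
`s ∉ P`. -/
theorem exists_smul_eq_one_tmul (w : FractionRing (R ⧸ P) ⊗[R] V) :
    ∃ s ∉ P, ∃ v : V, s • w = 1 ⊗ₜ[R] v := by
  induction w with
  | zero => exact ⟨1, P.one_notMem, 0, by simp⟩
  | tmul c v =>
    obtain ⟨a, b, hb, rfl⟩ := IsFractionRing.div_surjective (A := R ⧸ P) c
    obtain ⟨a, rfl⟩ := Ideal.Quotient.mk_surjective a
    obtain ⟨b, rfl⟩ := Ideal.Quotient.mk_surjective b
    have hbP : b ∉ P := fun h =>
      nonZeroDivisors.ne_zero hb (Ideal.Quotient.eq_zero_iff_mem.mpr h)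
    have hb0 : algebraMap R (FractionRing (R ⧸ P)) b ≠ 0 := fun h =>
      hbP ((algebraMap_fractionRing_quotient_eq_zero_iff P b).mp h)
    refine ⟨b, hbP, a • v, ?_⟩
    rw [TensorProduct.tmul_smul, TensorProduct.smul_tmul', TensorProduct.smul_tmul',
      Algebra.smul_def, Algebra.smul_def, mul_one]
    change (algebraMap R (FractionRing (R ⧸ P)) b *
      (algebraMap R (FractionRing (R ⧸ P)) a / algebraMap R (FractionRing (R ⧸ P)) b)) ⊗ₜ[R] v = _
    rw [mul_div_cancel₀ _ hb0]
  | add x y hx hy =>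
    obtain ⟨s, hs, v, hv⟩ := hx
    obtain ⟨t, ht, u, hu⟩ := hy
    refine ⟨s * t, fun h => (Ideal.IsPrime.mem_or_mem ‹_› h).elim hs ht, t • v + s • u, ?_⟩
    rw [TensorProduct.tmul_add, TensorProduct.tmul_smul, TensorProduct.tmul_smul, ← hv, ← hu,
      smul_add, mul_smul, mul_smul, smul_comm s t x]

/-- The kernel of `V → k(P) ⊗ V` consists of the elements that are torsion modulo `P V`. -/
theorem exists_smul_mem_of_one_tmul_eq_zero {v : V}
    (hv : (1 : FractionRing (R ⧸ P)) ⊗ₜ[R] v = 0) :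
    ∃ s ∉ P, s • v ∈ P • (⊤ : Submodule R V) := by
  let M := V ⧸ P • (⊤ : Submodule R V)
  let f : V →ₗ[R] FractionRing (R ⧸ P) ⊗[R ⧸ P] M :=
    { toFun := fun v => 1 ⊗ₜ Submodule.Quotient.mk v
      map_add' := fun x y => by rw [Submodule.Quotient.mk_add, TensorProduct.tmul_add]
      map_smul' := fun r x => by
        have h : (Submodule.Quotient.mk (r • x) : M) =
            Ideal.Quotient.mk P r • (Submodule.Quotient.mk x : M) := rfl
        rw [h, ← TensorProduct.smul_tmul, RingHom.id_apply, TensorProduct.smul_tmul']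
        congr 1
        rw [Algebra.smul_def, Algebra.smul_def]
        rfl }
  have h0 : f v = 0 := by
    have := congrArg (f.liftBaseChange (FractionRing (R ⧸ P))) hv
    rwa [LinearMap.liftBaseChange_tmul, one_smul, map_zero] at this
  obtain ⟨⟨s, hs⟩, h⟩ := (IsLocalizedModule.eq_zero_iff (nonZeroDivisors (R ⧸ P))
    (TensorProduct.mk (R ⧸ P) (FractionRing (R ⧸ P)) M 1)).mp h0
  obtain ⟨s, rfl⟩ := Ideal.Quotient.mk_surjective s
  refine ⟨s, fun h' => nonZeroDivisors.ne_zero hs (Ideal.Quotient.eq_zero_iff_mem.mpr h'), ?_⟩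
  exact (Submodule.Quotient.mk_eq_zero _).mp h

end ResidueField

section GroupAlgebra

variable {R G V : Type*} [CommRing R] [Group G] [AddCommGroup V] [Module R V]
  [Module (MonoidAlgebra R G) V] [IsScalarTower R (MonoidAlgebra R G) V]

theorem le_of_smul_top_le_of_injective
    (hinj : Function.Injective fun I : Ideal R => I • (⊤ : Submodule R V)) {I J : Ideal R}
    (h : I • (⊤ : Submodule R V) ≤ J • ⊤) : I ≤ J := by
  rw [← sup_eq_right]
  apply hinj
  change (I ⊔ J) • (⊤ : Submodule R V) = J • ⊤
  rw [Submodule.sup_smul, sup_eq_right.mpr h]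

/-- `V / P V` has no `R / P`-torsion when `I ↦ I V` is a bijection onto `R[G]`-submodules. -/
theorem mem_smul_top_of_smul_mem
    (hinj : Function.Injective fun I : Ideal R => I • (⊤ : Submodule R V))
    (hsurj : ∀ N : Submodule (MonoidAlgebra R G) V, ∃ I : Ideal R,
      I • (⊤ : Submodule R V) = N.restrictScalars R)
    (P : Ideal R) [P.IsPrime]
    (hP : ∃ N : Submodule (MonoidAlgebra R G) V,
      N.restrictScalars R = P • (⊤ : Submodule R V))
    {s : R} (hs : s ∉ P) {v : V} (hv : s • v ∈ P • (⊤ : Submodule R V)) :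
    v ∈ P • (⊤ : Submodule R V) := by
  obtain ⟨N, hN⟩ := hP
  obtain ⟨I, hI⟩ := hsurj (Submodule.span _ {v})
  have hle : Ideal.span {s} * I ≤ P := by
    apply le_of_smul_top_le_of_injective hinj
    rw [Submodule.mul_smul, hI, ← hN, Submodule.ideal_span_singleton_smul]
    rintro _ ⟨x, hx, rfl⟩
    obtain ⟨a, rfl⟩ := Submodule.mem_span_singleton.mp hx
    have hsv : s • v ∈ N := by rwa [← hN] at hv
    have hcomm : s • a • v = a • s • v := by
      rw [← algebraMap_smul (MonoidAlgebra R G) s (a • v), ← mul_smul, Algebra.commutes,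
        mul_smul, algebraMap_smul]
    change s • a • v ∈ N
    rw [hcomm]
    exact N.smul_mem a hsv
  have hIP : I ≤ P := ((Ideal.IsPrime.mul_le ‹_›).mp hle).resolve_left fun h =>
    hs (h (Ideal.mem_span_singleton_self s))
  refine Submodule.smul_mono_left hIP ?_
  rw [hI]
  exact Submodule.mem_span_singleton_self v

/-- The preimage in `V` of a `k(P)[G]`-submodule of `k(P) ⊗ V`. -/
def residueComap (P : Ideal R) [P.IsPrime]
    (W : Submodule (MonoidAlgebra (FractionRing (R ⧸ P)) G) (residueRep R G V P).asModule) :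
    Submodule (MonoidAlgebra R G) V where
  carrier := {v | (residueRep R G V P).asModuleEquiv.symm (1 ⊗ₜ[R] v) ∈ W}
  add_mem' {x y} hx hy := by
    simp only [Set.mem_ofPred_eq] at hx hy ⊢
    rw [TensorProduct.tmul_add, map_add]
    exact W.add_mem hx hy
  zero_mem' := by
    simp only [Set.mem_ofPred_eq]
    rw [TensorProduct.tmul_zero, map_zero]
    exact W.zero_mem
  smul_mem' a v hv := by
    simp only [Set.mem_ofPred_eq] at hv ⊢
    induction a using MonoidAlgebra.induction_on with
    | of g =>
      have h := W.smul_mem (MonoidAlgebra.of _ G g) hv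
      rwa [← Representation.asModuleEquiv_symm_map_rho] at h
    | add a b ha hb =>
      rw [add_smul, TensorProduct.tmul_add, map_add]
      exact W.add_mem ha hb
    | smul r a ha =>
      have h := W.smul_mem (algebraMap (FractionRing (R ⧸ P)) _ (algebraMap R _ r)) ha
      rw [← Representation.asModuleEquiv_symm_map_smul, algebraMap_smul] at h
      rwa [smul_assoc, TensorProduct.tmul_smul]

end GroupAlgebra

/-- Let `G` be a group, `R` a commutative ring and `V` a module over
the group algebra `R[G]`. If `I ↦ I·V` is a bijection from the ideals of `R` onto the
`R[G]`-submodules of `V`, then for every prime ideal `P` of `R` the module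
`V ⊗_R k(P)`, where `k(P)` is the fraction field of `R/P`, is a nonzero simple
`k(P)[G]`-module. -/
theorem statement_14 {R G V : Type*} [CommRing R] [Group G] [AddCommGroup V]
    [Module R V] [Module (MonoidAlgebra R G) V] [IsScalarTower R (MonoidAlgebra R G) V]
    (hbij : Set.BijOn
      (fun I : Ideal R => ((I • (⊤ : Submodule R V) : Submodule R V) : Set V))
      Set.univ
      {s : Set V | ∃ N : Submodule (MonoidAlgebra R G) V, (N : Set V) = s})
    (P : Ideal R) [P.IsPrime] :
    Nontrivial ((residueRep R G V P).asModule) ∧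
    IsSimpleModule (MonoidAlgebra (FractionRing (R ⧸ P)) G)
      ((residueRep R G V P).asModule) := by
  have hinj : Function.Injective fun I : Ideal R => I • (⊤ : Submodule R V) := fun I J h =>
    hbij.injOn (Set.mem_univ I) (Set.mem_univ J) (congrArg SetLike.coe h)
  have hsurj (N : Submodule (MonoidAlgebra R G) V) : ∃ I : Ideal R,
      I • (⊤ : Submodule R V) = N.restrictScalars R := by
    obtain ⟨I, -, hI⟩ := hbij.surjOn ⟨N, rfl⟩
    exact ⟨I, SetLike.coe_injective hI⟩
  have hP : ∃ N : Submodule (MonoidAlgebra R G) V,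
      N.restrictScalars R = P • (⊤ : Submodule R V) := by
    obtain ⟨N, hN⟩ := hbij.mapsTo (Set.mem_univ P)
    exact ⟨N, SetLike.coe_injective hN⟩
  have hnt : Nontrivial (FractionRing (R ⧸ P) ⊗[R] V) := by
    by_contra hsub
    rw [not_nontrivial_iff_subsingleton] at hsub
    refine Ideal.IsPrime.ne_top ‹P.IsPrime› (top_le_iff.mp ?_)
    refine le_of_smul_top_le_of_injective hinj fun v _ => ?_
    obtain ⟨s, hs, hsv⟩ := exists_smul_mem_of_one_tmul_eq_zero P
      (Subsingleton.elim ((1 : FractionRing (R ⧸ P)) ⊗ₜ[R] v) 0)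
    exact mem_smul_top_of_smul_mem hinj hsurj P hP hs hsv
  have hnt' : Nontrivial (residueRep R G V P).asModule := hnt
  refine ⟨hnt', (isSimpleModule_iff _ _).mpr ⟨fun W => or_iff_not_imp_left.mpr fun hW => ?_⟩⟩
  have hscalar (c : FractionRing (R ⧸ P)) {w : FractionRing (R ⧸ P) ⊗[R] V}
      (hw : (residueRep R G V P).asModuleEquiv.symm w ∈ W) :
      (residueRep R G V P).asModuleEquiv.symm (c • w) ∈ W := by
    rw [Representation.asModuleEquiv_symm_map_smul]
    exact W.smul_mem _ hw
  have hunit {s : R} (hs : s ∉ P) (w : FractionRing (R ⧸ P) ⊗[R] V) :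
      (algebraMap R (FractionRing (R ⧸ P)) s)⁻¹ • s • w = w := by
    rw [← algebraMap_smul (FractionRing (R ⧸ P)) s w,
      inv_smul_smul₀ (mt (algebraMap_fractionRing_quotient_eq_zero_iff P s).mp hs)]
  obtain ⟨I, hI⟩ := hsurj (residueComap P W)
  have hIP : ¬ I ≤ P := by
    intro hIP
    obtain ⟨w, hwW, hw⟩ := W.ne_bot_iff.mp hW
    obtain ⟨s, hs, v, hv⟩ := exists_smul_eq_one_tmul P ((residueRep R G V P).asModuleEquiv w)
    have hmem : v ∈ (residueComap P W).restrictScalars R := by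
      change (residueRep R G V P).asModuleEquiv.symm (1 ⊗ₜ[R] v) ∈ W
      rw [← hv, ← algebraMap_smul (FractionRing (R ⧸ P)) s]
      exact hscalar _ hwW
    rw [← hI] at hmem
    rw [one_tmul_eq_zero_of_mem_smul_top P (Submodule.smul_mono_left hIP hmem)] at hv
    apply hw
    have h := hunit hs ((residueRep R G V P).asModuleEquiv w)
    rw [hv, smul_zero] at h
    exact h.symm
  obtain ⟨s, hsI, hsP⟩ := SetLike.not_le_iff_exists.mp hIP
  have hone (v : V) : (residueRep R G V P).asModuleEquiv.symm (1 ⊗ₜ[R] v) ∈ W := by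
    have h : s • v ∈ (residueComap P W).restrictScalars R :=
      hI ▸ Submodule.smul_mem_smul hsI Submodule.mem_top
    have h' : (residueRep R G V P).asModuleEquiv.symm (1 ⊗ₜ[R] (s • v)) ∈ W := h
    rw [TensorProduct.tmul_smul] at h'
    rw [← hunit hsP (1 ⊗ₜ[R] v)]
    exact hscalar _ h'
  refine eq_top_iff.mpr fun w _ => ?_
  obtain ⟨t, ht, v, hv⟩ := exists_smul_eq_one_tmul P ((residueRep R G V P).asModuleEquiv w)
  have h := hscalar (algebraMap R (FractionRing (R ⧸ P)) t)⁻¹ (hone v)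
  rw [← hv, hunit ht] at h
  exact h
end
end

section
/- Let p be a prime and n ≥ 1, let 𝒦 = ℚ(ζ_{p^n}) be the p^n-th cyclotomic field, and let 𝒜 be the integral closure of ℤ[1/p] in 𝒦. Then for every nonzero commutative ring ℬ and every ring homomorphism φ : 𝒜 → ℬ, the restriction of φ to the group μ^p(𝒜) = {ζ ∈ 𝒜^× : ζ^{p^k} = 1 for some k ≥ 0} of units of p-power order is injective. Consequently, for any nontrivial group homomorphism ψ : (F,+) → 𝒜^× from a finite field F of characteristic p, the composite φ ∘ ψ : F → ℬ^× is again nontrivial. -/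
noncomputable section

set_option maxHeartbeats 1000000
set_option synthInstance.maxHeartbeats 1000000

universe u v

section

variable {A B : Type*} [CommRing A] [IsDomain A] [CommRing B] [Nontrivial B]

/-- If `p` is invertible in the domain `A`, no nontrivial `p`-th root of unity of `A` is sent to `1`
by a ring homomorphism to a nonzero ring: otherwise `p = ∑ i < p, φ (ω ^ i) = φ 0` would vanish. -/
theorem eq_one_of_map_eq_one_of_pow_eq_one {p : ℕ} (hp : IsUnit (p : A)) (φ : A →+* B) {ω : A}
    (hω : ω ^ p = 1) (hφ : φ ω = 1) : ω = 1 := by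
  by_contra hne
  have hsum : ∑ i ∈ Finset.range p, ω ^ i = 0 := by
    refine (mul_eq_zero.mp ?_).resolve_right (sub_ne_zero.mpr hne)
    rw [geom_sum_mul, hω, sub_self]
  have hzero : (p : B) = 0 := by simpa [hφ] using congrArg φ hsum
  have hunit : IsUnit (p : B) := by simpa using hp.map φ
  exact hunit.ne_zero hzero

theorem eq_one_of_map_eq_one_of_pow_pow_eq_one {p : ℕ} (hp : IsUnit (p : A)) (φ : A →+* B) (k : ℕ)
    {ζ : A} (hζ : ζ ^ p ^ k = 1) (hφ : φ ζ = 1) : ζ = 1 := by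
  induction k generalizing ζ with
  | zero => simpa using hζ
  | succ k ih =>
    refine eq_one_of_map_eq_one_of_pow_eq_one hp φ (ih ?_ ?_) hφ
    · rw [← pow_mul, ← pow_succ', hζ]
    · rw [map_pow, hφ, one_pow]

/-- If `p` is invertible in the domain `A`, a ring homomorphism from `A` to a nonzero ring is
injective on the units of `p`-power order. -/
theorem units_eq_of_map_eq_of_pow_pow_eq_one {p : ℕ} (hp : IsUnit (p : A)) (φ : A →+* B)
    {ζ₁ ζ₂ : Aˣ} (h₁ : ∃ k : ℕ, ζ₁ ^ p ^ k = 1) (h₂ : ∃ k : ℕ, ζ₂ ^ p ^ k = 1)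
    (hφ : φ ζ₁ = φ ζ₂) : ζ₁ = ζ₂ := by
  obtain ⟨k, hk⟩ := h₁
  obtain ⟨l, hl⟩ := h₂
  have hpow : (ζ₁ * ζ₂⁻¹) ^ p ^ (k + l) = 1 := by
    rw [mul_pow, inv_pow, pow_add, pow_mul, hk, mul_comm (p ^ k), pow_mul, hl]
    simp
  have hmap : φ ((ζ₁ * ζ₂⁻¹ : Aˣ) : A) = 1 := by
    rw [Units.val_mul, map_mul, hφ, ← map_mul, Units.mul_inv, map_one]
  refine mul_inv_eq_one.mp (Units.ext ?_)
  exact eq_one_of_map_eq_one_of_pow_pow_eq_one hp φ (k + l)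
    (by simpa using congrArg Units.val hpow) hmap

/-- If `p` is invertible in the domain `A`, the composite of a nontrivial character of an additive
group of exponent `p` with a ring homomorphism from `A` to a nonzero ring is nontrivial. -/
theorem exists_map_ne_one_of_exists_ne_one {G : Type*} [AddCommGroup G] {p : ℕ}
    (hG : ∀ x : G, p • x = 0) (hp : IsUnit (p : A)) (φ : A →+* B) (ψ : G → Aˣ)
    (hψ : ∀ x y : G, ψ (x + y) = ψ x * ψ y) (hne : ∃ x : G, ψ x ≠ 1) :
    ∃ x : G, φ (ψ x) ≠ 1 := by
  obtain ⟨x, hx⟩ := hne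
  refine ⟨x, fun hφ ↦ hx (Units.ext ?_)⟩
  let χ : AddChar G Aˣ :=
    { toFun := ψ
      map_zero_eq_one' := by simpa using hψ 0 0
      map_add_eq_mul' := hψ }
  have hpow : ψ x ^ p = 1 := by
    have h := χ.map_nsmul_eq_pow p x
    rw [hG, χ.map_zero_eq_one] at h
    exact h.symm
  exact eq_one_of_map_eq_one_of_pow_eq_one hp φ (by simpa using congrArg Units.val hpow) hφ

end

theorem isUnit_natCast_Aint (p : ℕ) [NeZero p] (m : ℕ+) : IsUnit (p : Aint p m) := by
  have h := (IsLocalization.Away.algebraMap_isUnit (S := Localization.Away (p : ℤ)) (p : ℤ)).map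
    (algebraMap (Localization.Away (p : ℤ)) (Aint p m))
  simpa using h

/-- Let `𝒜` be the integral closure of `ℤ[1/p]` in `ℚ(ζ_{p^n})`,
`n ≥ 1`. For every nonzero commutative ring `ℬ` and ring homomorphism `φ : 𝒜 → ℬ`,
`φ` is injective on the group `μ^p(𝒜)` of units of `p`-power order; consequently,
for every nontrivial additive character `ψ : F → 𝒜ˣ` of a finite field `F` of
characteristic `p`, the composite `φ ∘ ψ` is again nontrivial. -/
theorem statement_15 (p : ℕ+) [Fact (Nat.Prime (p : ℕ))] (n : ℕ) (hn : 1 ≤ n) :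
    (∀ (ℬ : Type u) [CommRing ℬ], Nontrivial ℬ →
      ∀ φ : ↥(Aint (p : ℕ) (p ^ n)) →+* ℬ,
        ∀ ζ₁ ζ₂ : (↥(Aint (p : ℕ) (p ^ n)))ˣ,
          (∃ k : ℕ, ζ₁ ^ ((p : ℕ) ^ k) = 1) → (∃ k : ℕ, ζ₂ ^ ((p : ℕ) ^ k) = 1) →
          φ (ζ₁ : ↥(Aint (p : ℕ) (p ^ n))) = φ (ζ₂ : ↥(Aint (p : ℕ) (p ^ n))) →
          ζ₁ = ζ₂) ∧
    (∀ (ℬ : Type u) [CommRing ℬ], Nontrivial ℬ →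
      ∀ φ : ↥(Aint (p : ℕ) (p ^ n)) →+* ℬ,
      ∀ (Fq : Type v) [Field Fq] [Fintype Fq] [CharP Fq (p : ℕ)],
        ∀ ψ : Fq → (↥(Aint (p : ℕ) (p ^ n)))ˣ,
          (∀ x y : Fq, ψ (x + y) = ψ x * ψ y) → (∃ x : Fq, ψ x ≠ 1) →
          ∃ x : Fq, φ ((ψ x : ↥(Aint (p : ℕ) (p ^ n)))) ≠ 1) := by
  have hp := isUnit_natCast_Aint (p : ℕ) (p ^ n)
  refine ⟨fun ℬ _ _ φ ζ₁ ζ₂ h₁ h₂ hφ ↦ ?_, fun ℬ _ _ φ Fq _ _ _ ψ hψ hne ↦ ?_⟩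
  · exact units_eq_of_map_eq_of_pow_pow_eq_one (A := Aint (p : ℕ) (p ^ n)) hp φ h₁ h₂ hφ
  · exact exists_map_ne_one_of_exists_ne_one (A := Aint (p : ℕ) (p ^ n)) (p := p)
      (fun x ↦ by rw [nsmul_eq_mul, CharP.cast_eq_zero, zero_mul]) hp φ ψ hψ hne
end
end
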